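/- arXiv:2303.04264 — 2 statements merged into one kernel-verified Lean document; each statement's English description precedes it below -/
import Mathlib

section
/- For every k ∈ {0,1,…,2n}, the set {v_S : S ⊆ I, |S| = k} is an A-basis of Λ_A^k, and {v_S : S ⊆ I} is an A-basis of Λ_A. Consequently Λ_A^k is a free A-module of rank binom(2n,k), Λ_A is a free A-module of rank 2^{2n}, and Λ_A^k = 0 for k > 2n. -/
noncomputable section

/-- The ring `A = ℤ[q,q⁻¹]` of integer Laurent polynomials. -/
abbrev AL : Type := LaurentPolynomial ℤ

/-- The quantum parameter `q ∈ A`. -/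
def qA : AL := LaurentPolynomial.T 1

/-- `q⁻¹ ∈ A`. -/
def qAinv : AL := LaurentPolynomial.T (-1)

/-- The index set `I = {1,…,n} ∪ {−n,…,−1}` as a finset of integers. -/
def Iset (n : ℕ) : Finset ℤ := (Finset.Icc (-(n : ℤ)) (n : ℤ)).erase 0

/-- The type of generators, indexed by `I`. -/
abbrev Gen (n : ℕ) : Type := {x : ℤ // x ∈ Iset n}

/-- The generator of the free algebra indexed by `x ∈ I` (junk value `0` otherwise). -/
def gn (n : ℕ) (x : ℤ) : FreeAlgebra AL (Gen n) :=
  if h : x ∈ Iset n then FreeAlgebra.ι AL (⟨x, h⟩ : Gen n) else 0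

/-- The defining relations of the quantum exterior algebra of type C. -/
inductive CRel (n : ℕ) : FreeAlgebra AL (Gen n) → FreeAlgebra AL (Gen n) → Prop
  | sq (x : ℤ) (hx : x ∈ Iset n) : CRel n (gn n x * gn n x) 0
  | posSwap (i j : ℕ) (h1 : 1 ≤ i) (h2 : i < j) (h3 : j ≤ n) :
      CRel n (gn n (j : ℤ) * gn n (i : ℤ)) ((-qA) • (gn n (i : ℤ) * gn n (j : ℤ)))
  | negSwap (i j : ℕ) (h1 : 1 ≤ i) (h2 : i < j) (h3 : j ≤ n) :
      CRel n (gn n (-(i : ℤ)) * gn n (-(j : ℤ))) ((-qA) • (gn n (-(j : ℤ)) * gn n (-(i : ℤ))))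
  | mixSwap (i j : ℕ) (h1 : 1 ≤ i) (h2 : i ≤ n) (h3 : 1 ≤ j) (h4 : j ≤ n) (h5 : i ≠ j) :
      CRel n (gn n (-(i : ℤ)) * gn n (j : ℤ)) ((-qA) • (gn n (j : ℤ) * gn n (-(i : ℤ))))
  | main (i : ℕ) (h1 : 1 ≤ i) (h2 : i ≤ n) :
      CRel n (gn n (-(i : ℤ)) * gn n (i : ℤ))
        ((-(qA ^ 2)) • (gn n (i : ℤ) * gn n (-(i : ℤ))) +
          (qA - qAinv) •
            ∑ k ∈ Finset.Icc 1 (n - i),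
              ((-qA) ^ (k + 1)) • (gn n ((i + k : ℕ) : ℤ) * gn n (-((i + k : ℕ) : ℤ))))

/-- The quantum exterior algebra of type C, `Λ_A`. -/
abbrev LamAlg (n : ℕ) : Type := RingQuot (CRel n)

/-- The generator `v_x ∈ Λ_A`. -/
def va (n : ℕ) (x : ℤ) : LamAlg n := RingQuot.mkAlgHom AL (CRel n) (gn n x)

/-- The minimum of a nonempty finset of integers with respect to the order of `I`
(positives first, then negatives). -/
def iMin (S : Finset ℤ) (h : S.Nonempty) : ℤ :=
  if hp : (S.filter (fun x => 0 < x)).Nonempty then (S.filter (fun x => 0 < x)).min' hp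
  else S.min' h

theorem iMin_mem (S : Finset ℤ) (h : S.Nonempty) : iMin S h ∈ S := by
  unfold iMin
  split
  · exact Finset.mem_of_mem_filter _ (Finset.min'_mem _ _)
  · exact Finset.min'_mem _ _

/-- The maximum of a nonempty finset of integers with respect to the order of `I`. -/
def iMax (S : Finset ℤ) (h : S.Nonempty) : ℤ :=
  if hp : (S.filter (fun x => x < 0)).Nonempty then (S.filter (fun x => x < 0)).max' hp
  else S.max' h

theorem iMax_mem (S : Finset ℤ) (h : S.Nonempty) : iMax S h ∈ S := by
  unfold iMax
  split
  · exact Finset.mem_of_mem_filter _ (Finset.max'_mem _ _)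
  · exact Finset.max'_mem _ _

/-- The standard monomial `v_S = v_{x_1} v_{x_2} ⋯ v_{x_m}` for `S = {x_1 < ⋯ < x_m}`
(in the order of `I`). -/
def vset (n : ℕ) (S : Finset ℤ) : LamAlg n :=
  if h : S.Nonempty then va n (iMin S h) * vset n (S.erase (iMin S h)) else 1
termination_by S.card
decreasing_by exact Finset.card_erase_lt_of_mem (iMin_mem S h)

/-- The reversed standard monomial `v_S^{rev} = v_{x_m} ⋯ v_{x_2} v_{x_1}`. -/
def vsetRev (n : ℕ) (S : Finset ℤ) : LamAlg n :=
  if h : S.Nonempty then va n (iMax S h) * vsetRev n (S.erase (iMax S h)) else 1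
termination_by S.card
decreasing_by exact Finset.card_erase_lt_of_mem (iMax_mem S h)

/-- `−S`. -/
def negSet (S : Finset ℤ) : Finset ℤ := S.image (fun x => -x)

/-- The degree-k part Λ_A^k: the A-submodule spanned by all products of k generators. -/
def LamDeg (n k : ℕ) : Submodule AL (LamAlg n) :=
  Submodule.span AL
    {x : LamAlg n | ∃ l : List ℤ, l.length = k ∧ (∀ j ∈ l, j ∈ Iset n) ∧
      x = (l.map (va n)).prod}

/-- A Fock-type module: operators `r t`, `s t` for `t < m` satisfying the relations of the quantum
exterior algebra of type C, where `r t` plays the role of `v_{m-t}` and `s t` that of `v_{-(m-t)}`,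
`Ω t` is the correction term in the relation between `s t` and `r t`, `σ` scales by `(-q) ^ degree`,
and `vac` is a cyclic vector. -/
structure IsFock {R M : Type*} [CommRing R] [AddCommGroup M] [Module R M] (q : R) (m : ℕ)
    (r s Ω : ℕ → Module.End R M) (σ : Module.End R M) (vac : M) : Prop where
  r_sq : ∀ t < m, ∀ x, r t (r t x) = 0
  s_sq : ∀ t < m, ∀ x, s t (s t x) = 0
  r_swap : ∀ t u, t < u → u < m → ∀ x, r t (r u x) = (-q) • r u (r t x)
  s_swap : ∀ t u, t < u → u < m → ∀ x, s u (s t x) = (-q) • s t (s u x)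
  mix : ∀ t < m, ∀ u < m, t ≠ u → ∀ x, s t (r u x) = (-q) • r u (s t x)
  straighten : ∀ t < m, ∀ x, s t (r t x) = (-(q ^ 2)) • r t (s t x) + Ω t x
  omega_zero : ∀ x, Ω 0 x = 0
  omega_succ : ∀ t < m, ∀ x, Ω (t + 1) x = (q ^ 3 - q) • r t (s t x) - q • Ω t x
  sigma_r : ∀ t < m, ∀ x, σ (r t x) = (-q) • r t (σ x)
  sigma_s : ∀ t < m, ∀ x, σ (s t x) = (-q) • s t (σ x)
  sigma_omega : ∀ x, σ (Ω m x) = (q ^ 2) • Ω m (σ x)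
  sigma_surj : Function.Surjective σ
  omega_r : ∀ t < m, ∀ x, Ω m (r t x) = r t (Ω m x)
  omega_s : ∀ t < m, ∀ x, Ω m (s t x) = s t (Ω m x)
  cyclic : ∀ N : Submodule R M, vac ∈ N → (∀ t < m, ∀ x ∈ N, r t x ∈ N) →
    (∀ t < m, ∀ x ∈ N, s t x ∈ N) → N = ⊤

section FockStep

variable {R M : Type*} [CommRing R] [AddCommGroup M] [Module R M]

/-- The operator `(x₀, x₁, x₂, x₃) ↦ (f x₀, a f x₁, b f x₂, c f x₃)`. -/
def diagEnd (a b c : R) (f : Module.End R M) : Module.End R (M × M × M × M) where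
  toFun x := (f x.1, a • f x.2.1, b • f x.2.2.1, c • f x.2.2.2)
  map_add' x y := by simp
  map_smul' k x := by simp [smul_comm k]

/-- Left multiplication by the new smallest generator on
`M ⊕ v M ⊕ M w ⊕ v M w`. -/
def posEnd : Module.End R (M × M × M × M) where
  toFun x := (0, x.1, 0, x.2.2.1)
  map_add' x y := by simp
  map_smul' k x := by simp

/-- Left multiplication by the new largest generator on
`M ⊕ v M ⊕ M w ⊕ v M w`. -/
def negEnd (q : R) (σ Ω : Module.End R M) : Module.End R (M × M × M × M) where
  toFun x := (Ω x.2.1, 0, σ x.1 + Ω x.2.2.2, (-(q ^ 2)) • σ x.2.1)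
  map_add' x y := by simp [add_add_add_comm]
  map_smul' k x := by simp [smul_comm k]

@[simp] theorem diagEnd_apply (a b c : R) (f : Module.End R M) (x : M × M × M × M) :
    diagEnd a b c f x = (f x.1, a • f x.2.1, b • f x.2.2.1, c • f x.2.2.2) := rfl

@[simp] theorem posEnd_apply (x : M × M × M × M) :
    (posEnd : Module.End R (M × M × M × M)) x = (0, x.1, 0, x.2.2.1) := rfl

@[simp] theorem negEnd_apply (q : R) (σ Ω : Module.End R M) (x : M × M × M × M) :
    negEnd q σ Ω x = (Ω x.2.1, 0, σ x.1 + Ω x.2.2.2, (-(q ^ 2)) • σ x.2.1) := rfl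

/-- The operators `r` on the enlarged Fock module. -/
def rStep (q : R) (m : ℕ) (r : ℕ → Module.End R M) (t : ℕ) : Module.End R (M × M × M × M) :=
  if t = m then posEnd else diagEnd (-q) 1 (-q) (r t)

/-- The operators `s` on the enlarged Fock module. -/
def sStep (q : R) (m : ℕ) (s : ℕ → Module.End R M) (σ Ω : Module.End R M) (t : ℕ) :
    Module.End R (M × M × M × M) :=
  if t = m then negEnd q σ Ω else diagEnd (-q) 1 (-q) (s t)

/-- The operators `Ω` on the enlarged Fock module. -/
def omegaStep (q : R) (m : ℕ) (σ : Module.End R M) (Ω : ℕ → Module.End R M) (t : ℕ) :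
    Module.End R (M × M × M × M) :=
  if t = m + 1 then
    (q ^ 3 - q) • (posEnd * negEnd q σ (Ω m)) - q • diagEnd (q ^ 2) 1 (q ^ 2) (Ω m)
  else diagEnd (q ^ 2) 1 (q ^ 2) (Ω t)

theorem IsFock.step {q : R} (hq : IsUnit q) {m : ℕ} {r s Ω : ℕ → Module.End R M}
    {σ : Module.End R M} {vac : M} (H : IsFock q m r s Ω σ vac) :
    IsFock q (m + 1) (rStep q m r) (sStep q m s σ (Ω m)) (omegaStep q m σ Ω)
      (diagEnd (-q) (-q) (q ^ 2) σ) (vac, 0, 0, 0) := by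
  have rm : rStep q m r m = posEnd := by simp [rStep]
  have sm : sStep q m s σ (Ω m) m = negEnd q σ (Ω m) := by simp [sStep]
  have rt : ∀ t < m, rStep q m r t = diagEnd (-q) 1 (-q) (r t) := fun t ht => by
    simp [rStep, ht.ne]
  have st : ∀ t < m, sStep q m s σ (Ω m) t = diagEnd (-q) 1 (-q) (s t) := fun t ht => by
    simp [sStep, ht.ne]
  have om : omegaStep q m σ Ω (m + 1) = (q ^ 3 - q) • (posEnd * negEnd q σ (Ω m)) -
      q • diagEnd (q ^ 2) 1 (q ^ 2) (Ω m) := by simp [omegaStep]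
  have ot : ∀ t ≤ m, omegaStep q m σ Ω t = diagEnd (q ^ 2) 1 (q ^ 2) (Ω t) := fun t ht => by
    have : t ≠ m + 1 := by omega
    simp [omegaStep, this]
  have split : ∀ t, t < m + 1 → t < m ∨ t = m := fun t ht => by omega
  constructor
  · intro t ht x
    rcases split t ht with h | rfl
    · simp [rt t h, H.r_sq t h]
    · simp [rm]
  · intro t ht x
    rcases split t ht with h | rfl
    · simp [st t h, H.s_sq t h]
    · simp [sm, H.sigma_omega]
  · intro t u htu hu x
    rcases split u hu with h | rfl
    · simp only [rt t (htu.trans h), rt u h, diagEnd_apply, map_smul, H.r_swap t u htu h,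
        Prod.smul_mk, Prod.mk.injEq]
      refine ⟨?_, ?_, ?_, ?_⟩ <;> first | trivial | module
    · simp [rt t htu, rm]
  · intro t u htu hu x
    rcases split u hu with h | rfl
    · simp only [st t (htu.trans h), st u h, diagEnd_apply, map_smul, H.s_swap t u htu h,
        Prod.smul_mk, Prod.mk.injEq]
      refine ⟨?_, ?_, ?_, ?_⟩ <;> first | trivial | module
    · simp only [st t htu, sm, diagEnd_apply, negEnd_apply, map_smul, map_add, H.omega_s t htu,
        H.sigma_s t htu, Prod.smul_mk, Prod.mk.injEq, smul_zero, map_zero]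
      refine ⟨?_, ?_, ?_, ?_⟩ <;> first | trivial | module
  · intro t ht u hu htu x
    rcases split t ht with h | rfl
    · rcases split u hu with h' | rfl
      · simp only [st t h, rt u h', diagEnd_apply, map_smul, H.mix t h u h' htu,
          Prod.smul_mk, Prod.mk.injEq]
        refine ⟨?_, ?_, ?_, ?_⟩ <;> first | trivial | module
      · simp [st t h, rm]
    · have h' : u < t := by omega
      simp only [rt u h', sm, diagEnd_apply, negEnd_apply, map_smul, map_add, H.omega_r u h',
        H.sigma_r u h', Prod.smul_mk, Prod.mk.injEq, smul_zero, map_zero]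
      refine ⟨?_, ?_, ?_, ?_⟩ <;> first | trivial | module
  · intro t ht x
    rw [ot t (by omega)]
    rcases split t ht with h | rfl
    · simp only [st t h, rt t h, diagEnd_apply, map_smul, H.straighten t h,
          Prod.smul_mk, Prod.mk.injEq, Prod.mk_add_mk]
      refine ⟨?_, ?_, ?_, ?_⟩ <;> first | trivial | module
    · simp only [rm, sm, diagEnd_apply, negEnd_apply, posEnd_apply, map_zero,
          Prod.smul_mk, Prod.mk.injEq, Prod.mk_add_mk]
      refine ⟨?_, ?_, ?_, ?_⟩ <;> first | trivial | module
  · intro x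
    simp [ot 0 (by omega), H.omega_zero]
  · intro t ht x
    rcases split t ht with h | rfl
    · simp only [ot t h.le, ot (t + 1) h, st t h, rt t h, diagEnd_apply, map_smul,
        H.omega_succ t h, Prod.smul_mk, Prod.mk.injEq, Prod.mk_sub_mk]
      refine ⟨?_, ?_, ?_, ?_⟩ <;> first | trivial | module
    · simp [om, rm, sm, ot t le_rfl]
  · intro t ht x
    rcases split t ht with h | rfl
    · simp only [rt t h, diagEnd_apply, map_smul, H.sigma_r t h, Prod.smul_mk, Prod.mk.injEq]
      refine ⟨?_, ?_, ?_, ?_⟩ <;> first | trivial | module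
    · simp only [rm, diagEnd_apply, posEnd_apply, map_zero, Prod.smul_mk, Prod.mk.injEq]
      refine ⟨?_, ?_, ?_, ?_⟩ <;> first | trivial | module
  · intro t ht x
    rcases split t ht with h | rfl
    · simp only [st t h, diagEnd_apply, map_smul, H.sigma_s t h, Prod.smul_mk, Prod.mk.injEq]
      refine ⟨?_, ?_, ?_, ?_⟩ <;> first | trivial | module
    · simp only [sm, diagEnd_apply, negEnd_apply, map_zero, map_add, map_smul, H.sigma_omega,
        Prod.smul_mk, Prod.mk.injEq]
      refine ⟨?_, ?_, ?_, ?_⟩ <;> first | trivial | module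
  · intro x
    simp only [om, LinearMap.sub_apply, LinearMap.smul_apply, Module.End.mul_apply, diagEnd_apply,
      negEnd_apply, posEnd_apply, map_zero, map_add, map_sub, map_smul, H.sigma_omega,
        Prod.smul_mk, Prod.mk.injEq, Prod.mk_sub_mk]
    refine ⟨?_, ?_, ?_, ?_⟩ <;> first | trivial | module
  · rintro ⟨y₀, y₁, y₂, y₃⟩
    obtain ⟨p, hp⟩ := hq.exists_left_inv
    obtain ⟨x₀, rfl⟩ := H.sigma_surj y₀
    obtain ⟨x₁, rfl⟩ := H.sigma_surj y₁
    obtain ⟨x₂, rfl⟩ := H.sigma_surj y₂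
    obtain ⟨x₃, rfl⟩ := H.sigma_surj y₃
    refine ⟨(x₀, (-p) • x₁, (-p) • x₂, (p ^ 2) • x₃), ?_⟩
    have hp' : q * p = 1 := by rw [mul_comm, hp]
    simp [smul_smul, hp', ← mul_pow]
  · intro t ht x
    rcases split t ht with h | rfl
    · simp only [om, rt t h, LinearMap.sub_apply, LinearMap.smul_apply, Module.End.mul_apply,
        diagEnd_apply, negEnd_apply, posEnd_apply, map_zero, map_add, map_sub, map_smul,
        H.omega_r t h, H.sigma_r t h, Prod.smul_mk, Prod.mk.injEq, Prod.mk_sub_mk]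
      refine ⟨?_, ?_, ?_, ?_⟩ <;> first | trivial | module
    · simp only [om, rm, LinearMap.sub_apply, LinearMap.smul_apply, Module.End.mul_apply,
        diagEnd_apply, negEnd_apply, posEnd_apply, map_zero,
        Prod.smul_mk, Prod.mk.injEq, Prod.mk_sub_mk]
      refine ⟨?_, ?_, ?_, ?_⟩ <;> first | trivial | module
  · intro t ht x
    rcases split t ht with h | rfl
    · simp only [om, st t h, LinearMap.sub_apply, LinearMap.smul_apply, Module.End.mul_apply,
        diagEnd_apply, negEnd_apply, posEnd_apply, map_zero, map_add, map_sub, map_smul,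
        H.omega_s t h, H.sigma_s t h, Prod.smul_mk, Prod.mk.injEq, Prod.mk_sub_mk]
      refine ⟨?_, ?_, ?_, ?_⟩ <;> first | trivial | module
    · simp only [om, sm, LinearMap.sub_apply, LinearMap.smul_apply, Module.End.mul_apply,
        diagEnd_apply, negEnd_apply, posEnd_apply, map_zero, map_add, map_sub, map_smul,
        H.sigma_omega, Prod.smul_mk, Prod.mk.injEq, Prod.mk_sub_mk]
      refine ⟨?_, ?_, ?_, ?_⟩ <;> first | trivial | module
  · intro N hvac hr hs
    have h₀ : N.comap (LinearMap.inl R M (M × M × M)) = ⊤ := by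
      refine H.cyclic _ hvac (fun t ht x hx => ?_) (fun t ht x hx => ?_)
      · have h := hr t (by omega) _ hx
        simpa [rt t ht, ← Prod.zero_eq_mk] using h
      · have h := hs t (by omega) _ hx
        simpa [st t ht, ← Prod.zero_eq_mk] using h
    have e₀ : ∀ x : M, (x, 0, 0, 0) ∈ N := fun x => by
      have : x ∈ N.comap (LinearMap.inl R M (M × M × M)) := h₀ ▸ Submodule.mem_top
      exact this
    have e₁ : ∀ x : M, (0, x, 0, 0) ∈ N := fun x => by
      simpa [rm] using hr m (by omega) _ (e₀ x)
    have e₂ : ∀ x : M, (0, 0, x, 0) ∈ N := fun x => by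
      obtain ⟨y, rfl⟩ := H.sigma_surj x
      simpa [sm] using hs m (by omega) _ (e₀ y)
    have e₃ : ∀ x : M, (0, 0, 0, x) ∈ N := fun x => by
      simpa [rm] using hr m (by omega) _ (e₂ x)
    refine eq_top_iff.2 fun x _ => ?_
    obtain ⟨x₀, x₁, x₂, x₃⟩ := x
    simpa using N.add_mem (N.add_mem (e₀ x₀) (e₁ x₁)) (N.add_mem (e₂ x₂) (e₃ x₃))

theorem IsFock.omega_eq_sum {q p : R} (hp : p * q = 1) {m : ℕ} {r s Ω : ℕ → Module.End R M}
    {σ : Module.End R M} {vac : M} (H : IsFock q m r s Ω σ vac) (t : ℕ) (ht : t ≤ m) (x : M) :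
    Ω t x = (q - p) • ∑ k ∈ Finset.Icc 1 t, ((-q) ^ (k + 1)) • r (t - k) (s (t - k) x) := by
  have key : ∀ t ≤ m, Ω t x =
      (q - p) • ∑ k ∈ Finset.range t, ((-q) ^ (k + 2)) • r (t - (k + 1)) (s (t - (k + 1)) x) := by
    intro t
    induction t with
    | zero => intro _; simp [H.omega_zero]
    | succ t ih =>
      intro ht
      have hsum : ∑ k ∈ Finset.range t, ((-q) ^ (k + 1 + 2)) •
            r (t + 1 - (k + 1 + 1)) (s (t + 1 - (k + 1 + 1)) x) =
          (-q) • ∑ k ∈ Finset.range t, ((-q) ^ (k + 2)) •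
            r (t - (k + 1)) (s (t - (k + 1)) x) := by
        rw [Finset.smul_sum]
        refine Finset.sum_congr rfl fun k _ => ?_
        rw [smul_smul, ← pow_succ', show t + 1 - (k + 1 + 1) = t - (k + 1) by omega]
      rw [H.omega_succ t ht, ih (by omega), Finset.sum_range_succ', hsum]
      simp only [zero_add, Nat.add_sub_cancel, smul_add, smul_smul]
      have : q ^ 3 - q = (q - p) * (-q) ^ 2 := by linear_combination q * hp
      rw [this]
      module
  have shift := Finset.sum_Ico_add' (fun k => ((-q) ^ (k + 1)) • r (t - k) (s (t - k) x)) 0 t 1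
  rw [key t ht, Finset.range_eq_Ico]
  exact congrArg _ shift

end FockStep

theorem exists_isFock {R : Type} [CommRing R] [Nontrivial R] {q : R} (hq : IsUnit q) (m : ℕ) :
    ∃ (M : Type) (_ : AddCommGroup M) (_ : Module R M) (r s Ω : ℕ → Module.End R M)
      (σ : Module.End R M) (vac : M), Module.Free R M ∧ Module.Finite R M ∧
        Module.finrank R M = 4 ^ m ∧ IsFock q m r s Ω σ vac := by
  induction m with
  | zero =>
    refine ⟨R, inferInstance, inferInstance, 0, 0, 0, 1, 1, inferInstance, inferInstance,
      by simp, ?_⟩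
    constructor
    case cyclic =>
      intro N h _ _
      exact (Ideal.eq_top_iff_one N).2 h
    case sigma_surj => exact fun x => ⟨x, rfl⟩
    all_goals simp
  | succ m ih =>
    obtain ⟨M, _, _, r, s, Ω, σ, vac, _, _, hrank, H⟩ := ih
    refine ⟨M × M × M × M, inferInstance, inferInstance, _, _, _, _, _, inferInstance,
      inferInstance, ?_, H.step hq⟩
    simp only [Module.finrank_prod, hrank]
    ring

section Relations

variable {n : ℕ}

theorem va_sq {x : ℤ} (hx : x ∈ Iset n) : va n x * va n x = 0 := by
  simpa [va] using RingQuot.mkAlgHom_rel AL (CRel.sq x hx)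

theorem va_posSwap {i j : ℕ} (h1 : 1 ≤ i) (h2 : i < j) (h3 : j ≤ n) :
    va n (j : ℤ) * va n (i : ℤ) = (-qA) • (va n (i : ℤ) * va n (j : ℤ)) := by
  simpa only [va, map_mul, map_smul] using RingQuot.mkAlgHom_rel AL (CRel.posSwap i j h1 h2 h3)

theorem va_negSwap {i j : ℕ} (h1 : 1 ≤ i) (h2 : i < j) (h3 : j ≤ n) :
    va n (-(i : ℤ)) * va n (-(j : ℤ)) = (-qA) • (va n (-(j : ℤ)) * va n (-(i : ℤ))) := by
  simpa only [va, map_mul, map_smul] using RingQuot.mkAlgHom_rel AL (CRel.negSwap i j h1 h2 h3)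

theorem va_mixSwap {i j : ℕ} (h1 : 1 ≤ i) (h2 : i ≤ n) (h3 : 1 ≤ j) (h4 : j ≤ n) (h5 : i ≠ j) :
    va n (-(i : ℤ)) * va n (j : ℤ) = (-qA) • (va n (j : ℤ) * va n (-(i : ℤ))) := by
  simpa only [va, map_mul, map_smul] using
    RingQuot.mkAlgHom_rel AL (CRel.mixSwap i j h1 h2 h3 h4 h5)

theorem va_straighten {i : ℕ} (h1 : 1 ≤ i) (h2 : i ≤ n) :
    va n (-(i : ℤ)) * va n (i : ℤ) = (-(qA ^ 2)) • (va n (i : ℤ) * va n (-(i : ℤ))) +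
      (qA - qAinv) • ∑ k ∈ Finset.Icc 1 (n - i),
        ((-qA) ^ (k + 1)) • (va n ((i + k : ℕ) : ℤ) * va n (-((i + k : ℕ) : ℤ))) := by
  simpa only [va, map_mul, map_smul, map_add, map_sum] using
    RingQuot.mkAlgHom_rel AL (CRel.main i h1 h2)

end Relations

/-- The strict order of `I`: positive integers first, then negative ones. -/
def ILt (x y : ℤ) : Prop := (0 < x ∧ y < 0) ∨ (0 < x ∧ x < y) ∨ (x < y ∧ y < 0)

theorem mem_Iset {n : ℕ} {x : ℤ} : x ∈ Iset n ↔ x ≠ 0 ∧ -(n : ℤ) ≤ x ∧ x ≤ n := by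
  simp [Iset]

theorem eq_or_iLt_of_mem {S : Finset ℤ} (h : S.Nonempty) (h0 : ∀ z ∈ S, z ≠ 0) {z : ℤ}
    (hz : z ∈ S) : iMin S h = z ∨ ILt (iMin S h) z := by
  have hz0 := h0 z hz
  unfold iMin ILt
  split
  next hp =>
    have h1 := (Finset.mem_filter.1 (Finset.min'_mem _ hp)).2
    by_cases hz' : 0 < z
    · have h2 := Finset.min'_le (S.filter (fun x => 0 < x)) z (by simp [hz, hz'])
      omega
    · omega
  next hp =>
    have hneg : ∀ y ∈ S, y < 0 := by
      intro y hy
      by_contra hy'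
      have := h0 y hy
      exact hp ⟨y, by simp only [Finset.mem_filter]; exact ⟨hy, by omega⟩⟩
    have h1 := Finset.min'_le S z hz
    have h2 := hneg z hz
    omega

theorem iMin_eq {S : Finset ℤ} (h : S.Nonempty) (h0 : ∀ z ∈ S, z ≠ 0) {y : ℤ} (hy : y ∈ S)
    (hmin : ∀ z ∈ S, y = z ∨ ILt y z) : iMin S h = y := by
  have h1 := eq_or_iLt_of_mem h h0 hy
  have h2 := hmin _ (iMin_mem S h)
  unfold ILt at h1 h2
  omega

theorem vset_empty (n : ℕ) : vset n ∅ = 1 := by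
  rw [vset]; simp

theorem vset_of_nonempty (n : ℕ) {S : Finset ℤ} (h : S.Nonempty) :
    vset n S = va n (iMin S h) * vset n (S.erase (iMin S h)) := by
  rw [vset, dif_pos h]

theorem vset_insert (n : ℕ) {S : Finset ℤ} {x : ℤ} (h0 : ∀ z ∈ S, z ≠ 0) (hx0 : x ≠ 0)
    (hx : ∀ z ∈ S, ILt x z) : vset n (insert x S) = va n x * vset n S := by
  have hxS : x ∉ S := fun h => by
    have := hx x h
    unfold ILt at this
    omega
  have hm : iMin (insert x S) (Finset.insert_nonempty x S) = x := by
    refine iMin_eq _ ?_ (Finset.mem_insert_self x S) ?_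
    · simpa [hx0] using h0
    · simpa using fun z hz => Or.inr (hx z hz)
  rw [vset_of_nonempty n (Finset.insert_nonempty x S), hm, Finset.erase_insert hxS]

/-- If `x` skew-commutes with every earlier element of `S`, then `v_x v_S` is zero or a multiple
of the standard monomial `v_{S ∪ {x}}`. -/
theorem va_mul_vset_of_swap (n : ℕ) {x : ℤ} (hx : x ∈ Iset n) (S : Finset ℤ) (hS : S ⊆ Iset n)
    (hswap : ∀ y ∈ S, ILt y x → va n x * va n y = (-qA) • (va n y * va n x)) :
    (x ∈ S → va n x * vset n S = 0) ∧
      (x ∉ S → ∃ c : AL, va n x * vset n S = c • vset n (insert x S)) := by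
  induction hc : S.card generalizing S with
  | zero =>
    obtain rfl := Finset.card_eq_zero.1 hc
    refine ⟨by simp, fun _ => ⟨1, ?_⟩⟩
    rw [one_smul, vset_insert n (by simp) (mem_Iset.1 hx).1 (by simp)]
  | succ k ih =>
    have hne : S.Nonempty := Finset.card_pos.1 (by omega)
    have h0 : ∀ z ∈ S, z ≠ 0 := fun z hz => (mem_Iset.1 (hS hz)).1
    have hx0 := (mem_Iset.1 hx).1
    have hmem := iMin_mem S hne
    have hmin := fun z hz => eq_or_iLt_of_mem hne h0 (z := z) hz
    have hv := vset_of_nonempty n hne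
    generalize iMin S hne = y at hmem hmin hv
    have hy0 := h0 y hmem
    have hmin' : ∀ z ∈ S.erase y, ILt y z := fun z hz =>
      (hmin z (Finset.mem_of_mem_erase hz)).resolve_left (Finset.ne_of_mem_erase hz).symm
    by_cases hxy : x = y
    · subst hxy
      refine ⟨fun _ => ?_, fun h => absurd hmem h⟩
      rw [hv, ← mul_assoc, va_sq hx, zero_mul]
    · by_cases hlt : ILt y x
      · have hS' : S.erase y ⊆ Iset n := (Finset.erase_subset y S).trans hS
        obtain ⟨ih1, ih2⟩ := ih (S.erase y) hS'
          (fun z hz => hswap z (Finset.mem_of_mem_erase hz))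
          (by rw [Finset.card_erase_of_mem hmem, hc]; rfl)
        have hmul : va n x * vset n S = (-qA) • (va n y * (va n x * vset n (S.erase y))) := by
          rw [hv, ← mul_assoc, hswap y hmem hlt, smul_mul_assoc, mul_assoc]
        refine ⟨fun h => ?_, fun h => ?_⟩
        · rw [hmul, ih1 (Finset.mem_erase.2 ⟨hxy, h⟩), mul_zero, smul_zero]
        · obtain ⟨c, hcx⟩ := ih2 (fun h' => h (Finset.mem_of_mem_erase h'))
          refine ⟨-qA * c, ?_⟩
          have hins : insert x S = insert y (insert x (S.erase y)) := by
            rw [Finset.insert_comm, Finset.insert_erase hmem]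
          rw [hmul, hcx, hins, vset_insert n (S := insert x (S.erase y)) (x := y), mul_smul_comm,
            smul_smul]
          · simpa [hx0] using fun z _ hz => h0 z hz
          · exact hy0
          · intro z hz
            rcases Finset.mem_insert.1 hz with rfl | hz
            · exact hlt
            · exact hmin' z hz
      · have hxlt : ILt x y := by
          unfold ILt at hlt ⊢
          omega
        have hxz : ∀ z ∈ S, ILt x z := fun z hz => by
          have h1 := hmin z hz
          unfold ILt at h1 hxlt ⊢
          omega
        refine ⟨fun h => ?_, fun _ => ⟨1, ?_⟩⟩
        · have := hxz x h
          unfold ILt at this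
          omega
        · rw [one_smul, vset_insert n h0 hx0 hxz]

/-- The span of the standard monomials of degree `k`. -/
def stdSpan (n k : ℕ) : Submodule AL (LamAlg n) :=
  Submodule.span AL (Set.range (fun S : {S : Finset ℤ // S ⊆ Iset n ∧ S.card = k} => vset n S.1))

theorem vset_mem_stdSpan {n : ℕ} {S : Finset ℤ} (hS : S ⊆ Iset n) :
    vset n S ∈ stdSpan n S.card :=
  Submodule.subset_span ⟨⟨S, hS, rfl⟩, rfl⟩

theorem va_mul_vset_mem_of_swap {n : ℕ} {x : ℤ} (hx : x ∈ Iset n) {S : Finset ℤ} (hS : S ⊆ Iset n)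
    (hswap : ∀ y ∈ S, ILt y x → va n x * va n y = (-qA) • (va n y * va n x)) :
    va n x * vset n S ∈ stdSpan n (S.card + 1) := by
  obtain ⟨h1, h2⟩ := va_mul_vset_of_swap n hx S hS hswap
  by_cases h : x ∈ S
  · rw [h1 h]
    exact zero_mem _
  · obtain ⟨c, hc⟩ := h2 h
    rw [hc, ← Finset.card_insert_of_notMem h]
    exact Submodule.smul_mem _ _ (vset_mem_stdSpan (Finset.insert_subset hx hS))

theorem mul_mem_stdSpan {n k : ℕ} {a : LamAlg n}
    (ha : ∀ S : Finset ℤ, S ⊆ Iset n → S.card = k → a * vset n S ∈ stdSpan n (k + 1))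
    {w : LamAlg n} (hw : w ∈ stdSpan n k) : a * w ∈ stdSpan n (k + 1) := by
  have hle : stdSpan n k ≤ (stdSpan n (k + 1)).comap (LinearMap.mulLeft AL a) := by
    rw [stdSpan, Submodule.span_le]
    rintro _ ⟨⟨S, hS, hc⟩, rfl⟩
    exact ha S hS hc
  exact hle hw

theorem va_mul_vset_mem_of_pos {n : ℕ} {x : ℤ} (hx : x ∈ Iset n) (hx0 : 0 < x) {S : Finset ℤ}
    (hS : S ⊆ Iset n) : va n x * vset n S ∈ stdSpan n (S.card + 1) := by
  refine va_mul_vset_mem_of_swap hx hS fun y _ hyx => ?_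
  have hxn := mem_Iset.1 hx
  unfold ILt at hyx
  lift x to ℕ using hx0.le
  lift y to ℕ using by omega
  exact va_posSwap (by omega) (by omega) (by omega)

theorem va_pos_mul_mem {n k : ℕ} {x : ℤ} (hx : x ∈ Iset n) (hx0 : 0 < x) {w : LamAlg n}
    (hw : w ∈ stdSpan n k) : va n x * w ∈ stdSpan n (k + 1) :=
  mul_mem_stdSpan (fun _ hS hc => hc ▸ va_mul_vset_mem_of_pos hx hx0 hS) hw

theorem va_mul_vset_mem {n : ℕ} (k : ℕ) : ∀ x ∈ Iset n, ∀ S : Finset ℤ, S ⊆ Iset n → S.card = k →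
    va n x * vset n S ∈ stdSpan n (k + 1) := by
  induction k with
  | zero =>
    intro x hx S hS hc
    obtain rfl := Finset.card_eq_zero.1 hc
    have h := va_mul_vset_mem_of_swap hx hS (by simp)
    rwa [Finset.card_empty] at h
  | succ k ih =>
    intro x hx S hS hc
    have hxn := mem_Iset.1 hx
    by_cases hxp : 0 < x
    · exact hc ▸ va_mul_vset_mem_of_pos hx hxp hS
    have hne : S.Nonempty := Finset.card_pos.1 (by omega)
    have h0 : ∀ z ∈ S, z ≠ 0 := fun z hz => (mem_Iset.1 (hS hz)).1
    have hmem := iMin_mem S hne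
    have hmin := fun z hz => eq_or_iLt_of_mem hne h0 (z := z) hz
    have hv := vset_of_nonempty n hne
    generalize iMin S hne = y at hmem hmin hv
    have hyn := mem_Iset.1 (hS hmem)
    by_cases hyp : 0 < y
    · have hS' : S.erase y ⊆ Iset n := (Finset.erase_subset y S).trans hS
      have hc' : (S.erase y).card = k := by rw [Finset.card_erase_of_mem hmem, hc]; rfl
      have key : ∀ a b : ℤ, a ∈ Iset n → 0 < a → b ∈ Iset n →
          va n a * va n b * vset n (S.erase y) ∈ stdSpan n (k + 1 + 1) := fun a b ha ha0 hb => by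
        rw [mul_assoc]
        exact va_pos_mul_mem ha ha0 (ih b hb _ hS' hc')
      rw [hv, ← mul_assoc]
      obtain ⟨i, rfl⟩ : ∃ i : ℕ, x = -(i : ℤ) := ⟨(-x).toNat, by omega⟩
      lift y to ℕ using hyp.le
      by_cases hiy : i = y
      · subst hiy
        rw [va_straighten (by omega) (by omega), add_mul, smul_mul_assoc, smul_mul_assoc,
          Finset.sum_mul]
        refine add_mem (Submodule.smul_mem _ _ (key _ _ (hS hmem) hyp hx))
          (Submodule.smul_mem _ _ (sum_mem fun j hj => ?_))
        rw [Finset.mem_Icc] at hj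
        rw [smul_mul_assoc]
        exact Submodule.smul_mem _ _ (key _ _ (mem_Iset.2 (by omega)) (by omega)
          (mem_Iset.2 (by omega)))
      · rw [va_mixSwap (by omega) (by omega) (by omega) (by omega) hiy, smul_mul_assoc]
        exact Submodule.smul_mem _ _ (key _ _ (hS hmem) hyp hx)
    · rw [← hc]
      refine va_mul_vset_mem_of_swap hx hS fun z hz hzx => ?_
      have h1 := hmin z hz
      have hzn := mem_Iset.1 (hS hz)
      unfold ILt at h1 hzx
      obtain ⟨i, rfl⟩ : ∃ i : ℕ, x = -(i : ℤ) := ⟨(-x).toNat, by omega⟩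
      obtain ⟨j, rfl⟩ : ∃ j : ℕ, z = -(j : ℤ) := ⟨(-z).toNat, by omega⟩
      exact va_negSwap (by omega) (by omega) (by omega)

theorem va_mul_mem {n k : ℕ} {x : ℤ} (hx : x ∈ Iset n) {w : LamAlg n}
    (hw : w ∈ stdSpan n k) : va n x * w ∈ stdSpan n (k + 1) :=
  mul_mem_stdSpan (va_mul_vset_mem k x hx) hw

theorem exists_list_vset {n : ℕ} (k : ℕ) : ∀ S : Finset ℤ, S ⊆ Iset n → S.card = k →
    ∃ l : List ℤ, l.length = k ∧ (∀ j ∈ l, j ∈ Iset n) ∧ vset n S = (l.map (va n)).prod := by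
  induction k with
  | zero =>
    intro S hS hc
    obtain rfl := Finset.card_eq_zero.1 hc
    exact ⟨[], rfl, by simp, by simp [vset_empty]⟩
  | succ k ih =>
    intro S hS hc
    have hne : S.Nonempty := Finset.card_pos.1 (by omega)
    have hmem := iMin_mem S hne
    obtain ⟨l, hl, hlI, hlv⟩ := ih (S.erase (iMin S hne))
      ((Finset.erase_subset _ S).trans hS) (by rw [Finset.card_erase_of_mem hmem, hc]; rfl)
    exact ⟨iMin S hne :: l, by simp [hl], by simpa using ⟨hS hmem, hlI⟩,
      by rw [vset_of_nonempty n hne, hlv, List.map_cons, List.prod_cons]⟩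

theorem stdSpan_eq_LamDeg (n k : ℕ) : stdSpan n k = LamDeg n k := by
  refine le_antisymm (Submodule.span_le.2 ?_) (Submodule.span_le.2 ?_)
  · rintro _ ⟨⟨S, hS, hc⟩, rfl⟩
    exact Submodule.subset_span (exists_list_vset k S hS hc)
  · rintro _ ⟨l, hl, hlI, rfl⟩
    induction l generalizing k with
    | nil =>
      subst hl
      simpa [vset_empty] using vset_mem_stdSpan (Finset.empty_subset (Iset n))
    | cons x l ih =>
      subst hl
      rw [List.map_cons, List.prod_cons]
      exact va_mul_mem (hlI x (by simp)) (ih _ rfl fun j hj => hlI j (by simp [hj]))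

theorem eq_top_of_one_mem_of_va_mul_mem {n : ℕ} {N : Submodule AL (LamAlg n)} (h1 : 1 ∈ N)
    (hN : ∀ x ∈ Iset n, ∀ w ∈ N, va n x * w ∈ N) : N = ⊤ := by
  have key : ∀ a : FreeAlgebra AL (Gen n), ∀ w ∈ N, RingQuot.mkAlgHom AL (CRel n) a * w ∈ N := by
    intro a
    induction a using FreeAlgebra.induction with
    | grade0 c =>
      intro w hw
      rw [AlgHom.commutes, ← Algebra.smul_def]
      exact N.smul_mem c hw
    | grade1 x =>
      intro w hw
      have hx : RingQuot.mkAlgHom AL (CRel n) (FreeAlgebra.ι AL x) = va n x.1 := by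
        rw [va, gn, dif_pos x.2]
      rw [hx]
      exact hN x.1 x.2 w hw
    | mul a b ha hb =>
      intro w hw
      rw [map_mul, mul_assoc]
      exact ha _ (hb _ hw)
    | add a b ha hb =>
      intro w hw
      rw [map_add, add_mul]
      exact N.add_mem (ha _ hw) (hb _ hw)
  refine eq_top_iff.2 fun x _ => ?_
  obtain ⟨a, rfl⟩ := RingQuot.mkAlgHom_surjective AL (CRel n) x
  simpa using key a 1 h1

theorem span_vset_eq_top (n : ℕ) : Submodule.span AL
    (Set.range (fun S : {S : Finset ℤ // S ⊆ Iset n} => vset n S.1)) = ⊤ := by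
  have hle : ∀ k, stdSpan n k ≤ Submodule.span AL
      (Set.range (fun S : {S : Finset ℤ // S ⊆ Iset n} => vset n S.1)) := fun k => by
    refine Submodule.span_mono ?_
    rintro _ ⟨⟨S, hS, _⟩, rfl⟩
    exact ⟨⟨S, hS⟩, rfl⟩
  refine eq_top_of_one_mem_of_va_mul_mem
    (Submodule.subset_span ⟨⟨∅, Finset.empty_subset _⟩, vset_empty n⟩) fun x hx w hw => ?_
  have hsub : Submodule.span AL
      (Set.range (fun S : {S : Finset ℤ // S ⊆ Iset n} => vset n S.1)) ≤
      (Submodule.span AL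
        (Set.range (fun S : {S : Finset ℤ // S ⊆ Iset n} => vset n S.1))).comap
        (LinearMap.mulLeft AL (va n x)) := by
    refine Submodule.span_le.2 ?_
    rintro _ ⟨⟨S, hS⟩, rfl⟩
    exact hle _ (va_mul_vset_mem _ x hx S hS rfl)
  exact hsub hw

theorem card_Iset (n : ℕ) : (Iset n).card = 2 * n := by
  rw [Iset, Finset.card_erase_of_mem (by simp), Int.card_Icc]
  omega

theorem isUnit_qA : IsUnit qA := LaurentPolynomial.isUnit_T 1

theorem qAinv_mul_qA : qAinv * qA = 1 := by
  rw [qAinv, qA, ← LaurentPolynomial.T_add]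
  simp

section Representation

variable {n : ℕ} {M : Type} [AddCommGroup M] [Module AL M]

/-- The operator by which the generator `v_x` acts on a Fock module. -/
def fockGen (n : ℕ) (r s : ℕ → Module.End AL M) (x : ℤ) : Module.End AL M :=
  if 0 < x then r (n - x.toNat) else s (n - (-x).toNat)

theorem fockGen_pos (r s : ℕ → Module.End AL M) {i : ℕ} (hi : 1 ≤ i) :
    fockGen n r s (i : ℤ) = r (n - i) := by
  rw [fockGen, if_pos (by omega), Int.toNat_natCast]

theorem fockGen_neg (r s : ℕ → Module.End AL M) (i : ℕ) :
    fockGen n r s (-(i : ℤ)) = s (n - i) := by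
  rw [fockGen, if_neg (by omega), neg_neg, Int.toNat_natCast]

theorem lift_gn (f : ℤ → Module.End AL M) {x : ℤ} (hx : x ∈ Iset n) :
    FreeAlgebra.lift AL (fun y : Gen n => f y.1) (gn n x) = f x := by
  rw [gn, dif_pos hx, FreeAlgebra.lift_ι_apply]

theorem IsFock.lift_rel {r s Ω : ℕ → Module.End AL M} {σ : Module.End AL M} {vac : M}
    (H : IsFock qA n r s Ω σ vac) {a b : FreeAlgebra AL (Gen n)} (h : CRel n a b) :
    FreeAlgebra.lift AL (fun y : Gen n => fockGen n r s y.1) a =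
      FreeAlgebra.lift AL (fun y : Gen n => fockGen n r s y.1) b := by
  have gp : ∀ i : ℕ, 1 ≤ i → i ≤ n →
      FreeAlgebra.lift AL (fun y : Gen n => fockGen n r s y.1) (gn n (i : ℤ)) = r (n - i) :=
    fun i h1 h2 => by rw [lift_gn _ (mem_Iset.2 (by omega)), fockGen_pos _ _ h1]
  have gm : ∀ i : ℕ, 1 ≤ i → i ≤ n →
      FreeAlgebra.lift AL (fun y : Gen n => fockGen n r s y.1) (gn n (-(i : ℤ))) = s (n - i) :=
    fun i h1 h2 => by rw [lift_gn _ (mem_Iset.2 (by omega)), fockGen_neg]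
  ext x
  cases h with
  | sq y hy =>
    have hy' := mem_Iset.1 hy
    rw [map_mul, map_zero]
    by_cases hpos : 0 < y
    · lift y to ℕ using hpos.le
      rw [gp y (by omega) (by omega)]
      exact H.r_sq _ (by omega) x
    · obtain ⟨i, rfl⟩ : ∃ i : ℕ, y = -(i : ℤ) := ⟨(-y).toNat, by omega⟩
      rw [gm i (by omega) (by omega)]
      exact H.s_sq _ (by omega) x
  | posSwap i j h1 h2 h3 =>
    rw [map_smul, map_mul, map_mul, gp i h1 (by omega), gp j (by omega) h3]
    exact H.r_swap _ _ (by omega) (by omega) x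
  | negSwap i j h1 h2 h3 =>
    rw [map_smul, map_mul, map_mul, gm i h1 (by omega), gm j (by omega) h3]
    exact H.s_swap _ _ (by omega) (by omega) x
  | mixSwap i j h1 h2 h3 h4 h5 =>
    rw [map_smul, map_mul, map_mul, gm i h1 h2, gp j h3 h4]
    exact H.mix _ (by omega) _ (by omega) (by omega) x
  | main i h1 h2 =>
    rw [map_add, map_smul, map_smul, map_mul, map_mul, map_sum, gm i h1 h2, gp i h1 h2]
    have hsum : ∑ k ∈ Finset.Icc 1 (n - i),
        FreeAlgebra.lift AL (fun y : Gen n => fockGen n r s y.1)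
          (((-qA) ^ (k + 1)) • (gn n ((i + k : ℕ) : ℤ) * gn n (-((i + k : ℕ) : ℤ)))) =
        ∑ k ∈ Finset.Icc 1 (n - i), ((-qA) ^ (k + 1)) • (r (n - i - k) * s (n - i - k)) := by
      refine Finset.sum_congr rfl fun k hk => ?_
      rw [Finset.mem_Icc] at hk
      rw [map_smul, map_mul, gp (i + k) (by omega) (by omega), gm (i + k) (by omega) (by omega),
        Nat.sub_sub]
    rw [hsum]
    simp only [Module.End.mul_apply, LinearMap.add_apply, LinearMap.smul_apply,
      LinearMap.sum_apply]
    rw [H.straighten _ (by omega), H.omega_eq_sum qAinv_mul_qA _ (by omega)]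

end Representation

instance fintypeSubsets (n : ℕ) : Fintype {S : Finset ℤ // S ⊆ Iset n} :=
  Fintype.subtype (Iset n).powerset fun _ => Finset.mem_powerset

theorem card_subsets (n : ℕ) : Fintype.card {S : Finset ℤ // S ⊆ Iset n} = 2 ^ (2 * n) := by
  rw [Fintype.card_of_subtype (Iset n).powerset (fun _ => Finset.mem_powerset),
    Finset.card_powerset, card_Iset]

theorem linearIndependent_vset (n : ℕ) :
    LinearIndependent AL (fun S : {S : Finset ℤ // S ⊆ Iset n} => vset n S.1) := by
  obtain ⟨M, _, _, r, s, Ω, σ, vac, _, _, hrank, H⟩ := exists_isFock isUnit_qA n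
  let ρ : LamAlg n →ₐ[AL] Module.End AL M :=
    RingQuot.liftAlgHom AL ⟨FreeAlgebra.lift AL (fun y : Gen n => fockGen n r s y.1),
      fun _ _ h => H.lift_rel h⟩
  have hρ : ∀ x ∈ Iset n, ρ (va n x) = fockGen n r s x := fun x hx => by
    rw [← lift_gn (fockGen n r s) hx]
    exact RingQuot.liftAlgHom_mkAlgHom_apply AL _ _ _
  let φ : LamAlg n →ₗ[AL] M := (LinearMap.applyₗ vac).comp ρ.toLinearMap
  have hφ : ∀ w, φ w = ρ w vac := fun _ => rfl
  have hcl : ∀ x ∈ Iset n, ∀ v ∈ LinearMap.range φ, fockGen n r s x v ∈ LinearMap.range φ := by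
    rintro x hx _ ⟨w, rfl⟩
    exact ⟨va n x * w, by rw [hφ, hφ, map_mul, hρ x hx]; rfl⟩
  have hsurj : LinearMap.range φ = ⊤ := by
    refine H.cyclic _ ⟨1, by rw [hφ, map_one]; rfl⟩ (fun t ht v hv => ?_) (fun t ht v hv => ?_)
    · have h := hcl ((n - t : ℕ) : ℤ) (mem_Iset.2 (by omega)) v hv
      rwa [fockGen_pos _ _ (by omega), Nat.sub_sub_self ht.le] at h
    · have h := hcl (-((n - t : ℕ) : ℤ)) (mem_Iset.2 (by omega)) v hv
      rwa [fockGen_neg, Nat.sub_sub_self ht.le] at h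
  refine LinearIndependent.of_comp φ (linearIndependent_of_top_le_span_of_card_eq_finrank ?_ ?_)
  · rw [Set.range_comp, ← Submodule.map_span, span_vset_eq_top, Submodule.map_top, hsurj]
  · rw [hrank, card_subsets, pow_mul]
    norm_num

theorem linearIndependent_vset_card (n k : ℕ) : LinearIndependent AL
    (fun S : {S : Finset ℤ // S ⊆ Iset n ∧ S.card = k} => vset n S.1) :=
  (linearIndependent_vset n).comp
    (fun S : {S : Finset ℤ // S ⊆ Iset n ∧ S.card = k} =>
      (⟨S.1, S.2.1⟩ : {S : Finset ℤ // S ⊆ Iset n}))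
    (fun _ _ h => Subtype.ext (congrArg (fun S : {S : Finset ℤ // S ⊆ Iset n} => S.1) h))

theorem card_subsets_card (n k : ℕ) :
    Nat.card {S : Finset ℤ // S ⊆ Iset n ∧ S.card = k} = (2 * n).choose k := by
  rw [← card_Iset n, ← Finset.card_powersetCard]
  exact Nat.subtype_card _ fun S => Finset.mem_powersetCard

/-- the standard monomials {v_S : S ⊆ I, |S| = k} form an A-basis of Λ_A^k,
and {v_S : S ⊆ I} an A-basis of Λ_A; consequently Λ_A^k is free of rank binom(2n,k),
Λ_A is free of rank 2^{2n}, and Λ_A^k = 0 for k > 2n. -/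
theorem stmt0 (n : ℕ) (hn : 1 ≤ n) (k : ℕ) :
    (LinearIndependent AL
        (fun S : {S : Finset ℤ // S ⊆ Iset n ∧ S.card = k} => vset n S.1) ∧
      Submodule.span AL
          (Set.range (fun S : {S : Finset ℤ // S ⊆ Iset n ∧ S.card = k} => vset n S.1)) =
        LamDeg n k) ∧
    (LinearIndependent AL (fun S : {S : Finset ℤ // S ⊆ Iset n} => vset n S.1) ∧
      Submodule.span AL
          (Set.range (fun S : {S : Finset ℤ // S ⊆ Iset n} => vset n S.1)) = ⊤) ∧
    Module.Free AL ↥(LamDeg n k) ∧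
    Module.rank AL ↥(LamDeg n k) = (Nat.choose (2 * n) k : Cardinal) ∧
    Module.Free AL (LamAlg n) ∧
    Module.rank AL (LamAlg n) = (2 ^ (2 * n) : Cardinal) ∧
    (2 * n < k → LamDeg n k = ⊥) := by
  have hspan := stdSpan_eq_LamDeg n k
  rw [stdSpan] at hspan
  have hli := linearIndependent_vset_card n k
  have hfin : Finite {S : Finset ℤ // S ⊆ Iset n ∧ S.card = k} :=
    Finite.of_injective
      (fun S => (⟨S.1, S.2.1⟩ : {S : Finset ℤ // S ⊆ Iset n}))
      (fun _ _ h => Subtype.ext (congrArg (fun S : {S : Finset ℤ // S ⊆ Iset n} => S.1) h))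
  let B := Module.Basis.mk (linearIndependent_vset n) (span_vset_eq_top n).ge
  have hrank : Module.rank AL ↥(LamDeg n k) = (Nat.choose (2 * n) k : Cardinal) := by
    rw [← hspan, rank_span hli, Cardinal.mk_range_eq _ hli.injective,
      ← Nat.cast_card, card_subsets_card]
  refine ⟨⟨hli, hspan⟩, ⟨linearIndependent_vset n, span_vset_eq_top n⟩, ?_, hrank,
    Module.Free.of_basis B, ?_, fun hk => ?_⟩
  · rw [← hspan]
    exact Module.Free.of_basis (Module.Basis.span hli)
  · rw [rank_eq_card_basis B, card_subsets]
    norm_num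
  · have hempty : IsEmpty {S : Finset ℤ // S ⊆ Iset n ∧ S.card = k} := ⟨fun S => by
      have h := Finset.card_le_card S.2.1
      rw [card_Iset, S.2.2] at h
      omega⟩
    rw [← hspan, Set.range_eq_empty, Submodule.span_empty]

end
end

section
/- The operators e_i, f_i, k_i^{±1} (i ∈ {1,…,n}) on Λ satisfy the defining relations of the quantum group U_q(sp_{2n}): k_i k_j = k_j k_i for all i,j; k_i e_j k_i⁻¹ = q^{(α_i,α_j)}·e_j and k_i f_j k_i⁻¹ = q^{−(α_i,α_j)}·f_j for all i,j; e_i f_j − f_j e_i = δ_{ij}·(k_i − k_i⁻¹)/(q_i − q_i⁻¹) for all i,j; and for all i ≠ j the quantum Serre relations Σ_{s=0}^{1−a_{ij}} (−1)^s·binom_{q_i}(1−a_{ij}, s)·e_i^{1−a_{ij}−s} e_j e_i^s = 0 and Σ_{s=0}^{1−a_{ij}} (−1)^s·binom_{q_i}(1−a_{ij}, s)·f_i^{1−a_{ij}−s} f_j f_i^s = 0, where a_{ij} := 2(α_i,α_j)/(α_i,α_i) and binom_{q_i} denotes the Gaussian binomial coefficient in the variable q_i. -/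
noncomputable section

/-- The field `𝔽 = ℚ(q)`. -/
abbrev Fq : Type := RatFunc ℚ

/-- The quantum parameter `q`. -/
def qv : Fq := RatFunc.X

/-- Subsets of `I`, the index type for the standard basis. -/
abbrev Bset (n : ℕ) : Type := {S : Finset ℤ // S ⊆ Iset n}

/-- `Λ`, the free `𝔽`-vector space with basis `{v_S : S ⊆ I}`. -/
abbrev Lam (n : ℕ) : Type := Bset n →₀ Fq

/-- The standard basis vector `v_S`. -/
def bv (n : ℕ) (S : Bset n) : Lam n := Finsupp.single S 1

/-- The standard basis vector `v_T` for a finset `T ⊆ I` (and `0` for junk input). -/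
def vS (n : ℕ) (T : Finset ℤ) : Lam n :=
  if h : T ⊆ Iset n then Finsupp.single (⟨T, h⟩ : Bset n) (1 : Fq) else 0

/-- The linear operator on `Λ` determined by prescribed values on the standard basis. -/
def mkOp (n : ℕ) (g : Bset n → Lam n) : Module.End Fq (Lam n) :=
  Finsupp.linearCombination Fq g

/-- The four positions `{i, i+1, −i, −(i+1)}`. -/
def quad (i : ℤ) : Finset ℤ := {i, i + 1, -i, -(i + 1)}

/-- Value of `f_i` on `v_S`. -/
def fAct (n : ℕ) (i : ℤ) (S : Finset ℤ) : Lam n :=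
  if i = (n : ℤ) then
    (if (n : ℤ) ∈ S ∧ -(n : ℤ) ∉ S then vS n (insert (-(n : ℤ)) (S.erase (n : ℤ))) else 0)
  else
    (if S ∩ quad i = {i} then vS n (insert (i + 1) (S.erase i))
     else if S ∩ quad i = {-(i + 1)} then vS n (insert (-i) (S.erase (-(i + 1))))
     else if S ∩ quad i = ({i, -(i + 1)} : Finset ℤ) then
       vS n (insert (-i) (S.erase (-(i + 1)))) + qv⁻¹ • vS n (insert (i + 1) (S.erase i))
     else if S ∩ quad i = ({i, -i} : Finset ℤ) then qv • vS n (insert (i + 1) (S.erase i))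
     else if S ∩ quad i = ({i + 1, -(i + 1)} : Finset ℤ) then
       vS n (insert (-i) (S.erase (-(i + 1))))
     else if S ∩ quad i = ({i, -(i + 1), -i} : Finset ℤ) then vS n (insert (i + 1) (S.erase i))
     else if S ∩ quad i = ({i, i + 1, -(i + 1)} : Finset ℤ) then
       vS n (insert (-i) (S.erase (-(i + 1))))
     else 0)

/-- Value of `e_i` on `v_S`. -/
def eAct (n : ℕ) (i : ℤ) (S : Finset ℤ) : Lam n :=
  if i = (n : ℤ) then
    (if -(n : ℤ) ∈ S ∧ (n : ℤ) ∉ S then vS n (insert (n : ℤ) (S.erase (-(n : ℤ)))) else 0)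
  else
    (if S ∩ quad i = {-i} then vS n (insert (-(i + 1)) (S.erase (-i)))
     else if S ∩ quad i = {i + 1} then vS n (insert i (S.erase (i + 1)))
     else if S ∩ quad i = ({i + 1, -i} : Finset ℤ) then
       vS n (insert i (S.erase (i + 1))) + qv⁻¹ • vS n (insert (-(i + 1)) (S.erase (-i)))
     else if S ∩ quad i = ({i, -i} : Finset ℤ) then qv • vS n (insert (-(i + 1)) (S.erase (-i)))
     else if S ∩ quad i = ({i + 1, -(i + 1)} : Finset ℤ) then vS n (insert i (S.erase (i + 1)))
     else if S ∩ quad i = ({i, i + 1, -i} : Finset ℤ) then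
       vS n (insert (-(i + 1)) (S.erase (-i)))
     else if S ∩ quad i = ({i + 1, -(i + 1), -i} : Finset ℤ) then vS n (insert i (S.erase (i + 1)))
     else 0)

/-- Coefficient of `ε_j` in `wt(S)`. -/
def epsCoef (S : Finset ℤ) (j : ℤ) : ℤ :=
  (if j ∈ S then 1 else 0) - (if -j ∈ S then 1 else 0)

/-- The pairing `(α_i, wt S)`. -/
def alphaPair (n : ℕ) (i : ℤ) (S : Finset ℤ) : ℤ :=
  if i = (n : ℤ) then 2 * epsCoef S (n : ℤ) else epsCoef S i - epsCoef S (i + 1)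

/-- The operator `f_i` on `Λ`. -/
def fop (n : ℕ) (i : ℤ) : Module.End Fq (Lam n) := mkOp n (fun S => fAct n i S.1)

/-- The operator `e_i` on `Λ`. -/
def eop (n : ℕ) (i : ℤ) : Module.End Fq (Lam n) := mkOp n (fun S => eAct n i S.1)

/-- The operator `k_i` on `Λ`, `k_i · v_S = q^{(α_i, wt S)} v_S`. -/
def kop (n : ℕ) (i : ℤ) : Module.End Fq (Lam n) :=
  mkOp n (fun S => (qv ^ alphaPair n i S.1) • bv n S)

/-- The operator `k_i⁻¹` on `Λ`. -/
def kinvop (n : ℕ) (i : ℤ) : Module.End Fq (Lam n) :=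
  mkOp n (fun S => (qv ^ (-alphaPair n i S.1)) • bv n S)

/-- `S₀ = S ∩ (−S)`, the fully dotted columns. -/
def Szero (S : Finset ℤ) : Finset ℤ := S ∩ negSet S

/-- `S₀^c = (I∖S) ∩ (−(I∖S))`, the undotted columns. -/
def Szeroc (n : ℕ) (S : Finset ℤ) : Finset ℤ := (Iset n \ S) ∩ negSet (Iset n \ S)

/-- `w(S) = (|S₀| − |S₀^c|)/2`. -/
def wTot (n : ℕ) (S : Finset ℤ) : ℤ :=
  (((Szero S).card : ℤ) - ((Szeroc n S).card : ℤ)) / 2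

/-- `w_{>i}(S)`. -/
def wGt (n : ℕ) (i : ℤ) (S : Finset ℤ) : ℤ :=
  ((((Szero S).filter (fun x => i < |x| ∧ |x| ≤ (n : ℤ))).card : ℤ)
    - (((Szeroc n S).filter (fun x => i < |x| ∧ |x| ≤ (n : ℤ))).card : ℤ)) / 2

/-- `w_{<i}(S)`. -/
def wLt (n : ℕ) (i : ℤ) (S : Finset ℤ) : ℤ :=
  ((((Szeroc n S).filter (fun x => x ≠ 0 ∧ |x| < i)).card : ℤ)
    - (((Szero S).filter (fun x => x ≠ 0 ∧ |x| < i)).card : ℤ)) / 2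

/-- Value of `E` on `v_S`. -/
def EAct (n : ℕ) (S : Finset ℤ) : Lam n :=
  ∑ i ∈ (Finset.Icc (1 : ℤ) (n : ℤ)).filter (fun i => i ∈ Szeroc n S ∧ -i ∈ Szeroc n S),
    ((-qv) ^ wGt n i S) • vS n (insert i (insert (-i) S))

/-- Value of `F` on `v_S`. -/
def FAct (n : ℕ) (S : Finset ℤ) : Lam n :=
  ∑ i ∈ (Finset.Icc (1 : ℤ) (n : ℤ)).filter (fun i => i ∈ Szero S ∧ -i ∈ Szero S),
    ((-qv) ^ wLt n i S) • vS n ((S.erase i).erase (-i))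

/-- The operator `E` on `Λ`. -/
def Eop (n : ℕ) : Module.End Fq (Lam n) := mkOp n (fun S => EAct n S.1)

/-- The operator `F` on `Λ`. -/
def Fop (n : ℕ) : Module.End Fq (Lam n) := mkOp n (fun S => FAct n S.1)

/-- The operator `K` on `Λ`, `K · v_S = (−q)^{w(S)} v_S`. -/
def Kop (n : ℕ) : Module.End Fq (Lam n) := mkOp n (fun S => ((-qv) ^ wTot n S.1) • bv n S)

/-- The operator `K⁻¹` on `Λ`. -/
def Kinvop (n : ℕ) : Module.End Fq (Lam n) :=
  mkOp n (fun S => ((-qv) ^ (-wTot n S.1)) • bv n S)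

/-- Balanced quantum integer `[m]_x`. -/
def qNum (x : Fq) (m : ℕ) : Fq := (x ^ (m : ℤ) - x ^ (-(m : ℤ))) / (x - x⁻¹)

/-- Quantum factorial `[m]_x!`. -/
def qFact (x : Fq) (m : ℕ) : Fq := ∏ j ∈ Finset.range m, qNum x (j + 1)

/-- Gaussian binomial coefficient in the variable `x`. -/
def qBinom (x : Fq) (m s : ℕ) : Fq := qFact x m / (qFact x s * qFact x (m - s))

/-- The variable `q_i`: `q` for `i < n` and `q²` for `i = n`. -/
def qsub (n : ℕ) (i : ℤ) : Fq := if i = (n : ℤ) then qv ^ 2 else qv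

/-- The subring `A = ℤ[q,q⁻¹] ⊆ 𝔽`. -/
def Asub : Subring Fq := Subring.closure {qv, qv⁻¹}

/-- The `A`-lattice `Λ_A ⊆ Λ`: the `A`-span of all `v_S`. -/
def LamA (n : ℕ) : Set (Lam n) :=
  {x | ∃ c : Bset n →₀ Fq, (∀ S, c S ∈ Asub) ∧ x = c.sum (fun S a => a • bv n S)}

/-- The degree-`k` part `Λ^k ⊆ Λ`. -/
def Lk (n k : ℕ) : Submodule Fq (Lam n) :=
  Submodule.span Fq {x | ∃ S : Bset n, S.1.card = k ∧ x = bv n S}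

/-- The divided power `E^{(m)} = E^m/[m]!`. -/
def Ediv (n : ℕ) (m : ℕ) : Module.End Fq (Lam n) := (qFact qv m)⁻¹ • (Eop n ^ m)

/-- The divided power `F^{(m)} = F^m/[m]!`. -/
def Fdiv (n : ℕ) (m : ℕ) : Module.End Fq (Lam n) := (qFact qv m)⁻¹ • (Fop n ^ m)

/-- The coordinate vector of the simple root α_i. -/
def avec (n : ℕ) (i : ℤ) (t : ℤ) : ℤ :=
  if i = (n : ℤ) then (if t = (n : ℤ) then 2 else 0)
  else (if t = i then 1 else if t = i + 1 then -1 else 0)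

/-- The inner product (α_i, α_j). -/
def ip (n : ℕ) (i j : ℤ) : ℤ := ∑ t ∈ Finset.Icc (1 : ℤ) (n : ℤ), avec n i t * avec n j t

/-- The Cartan integer a_{ij} = 2(α_i,α_j)/(α_i,α_i). -/
def aij (n : ℕ) (i j : ℤ) : ℤ := 2 * ip n i j / ip n i i

/-- The occupation number of the site `p` in `S`. -/
def occ (p : ℤ) (S : Finset ℤ) : ℤ := if p ∈ S then 1 else 0

/-- The operator moving an element at `a` to the free site `b`, with weight `q ^ w S`. -/
def whop (n : ℕ) (w : Finset ℤ → ℤ) (a b : ℤ) : Module.End Fq (Lam n) :=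
  mkOp n (fun S =>
    if a ∈ S.1 ∧ b ∉ S.1 then (qv ^ w S.1) • vS n (insert b (S.1.erase a)) else 0)

/-- The diagonal operator `v_S ↦ q ^ w S • v_S`. -/
def qdiag (n : ℕ) (w : Finset ℤ → ℤ) : Module.End Fq (Lam n) :=
  mkOp n (fun S => (qv ^ w S.1) • bv n S)

theorem qv_ne_zero : qv ≠ 0 := RatFunc.X_ne_zero

theorem qv_pow_ne_one {k : ℕ} (hk : k ≠ 0) : qv ^ k ≠ 1 := by
  intro h
  have h1 : (algebraMap (Polynomial ℚ) (RatFunc ℚ)) (Polynomial.X ^ k)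
      = algebraMap (Polynomial ℚ) (RatFunc ℚ) 1 := by
    rw [map_pow, RatFunc.algebraMap_X, map_one]; exact h
  have h2 := RatFunc.algebraMap_injective ℚ h1
  have h3 := congrArg Polynomial.natDegree h2
  simp at h3
  exact hk h3

theorem mkOp_vS {n : ℕ} (g : Finset ℤ → Lam n) {T : Finset ℤ} (hT : T ⊆ Iset n) :
    mkOp n (fun S => g S.1) (vS n T) = g T := by
  simp [mkOp, vS, hT]

theorem vS_of_not_subset {n : ℕ} {T : Finset ℤ} (hT : ¬ T ⊆ Iset n) : vS n T = 0 := by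
  simp [vS, hT]

theorem end_ext {n : ℕ} {f g : Module.End Fq (Lam n)}
    (h : ∀ T, T ⊆ Iset n → f (vS n T) = g (vS n T)) : f = g := by
  apply Finsupp.lhom_ext'
  intro S
  apply LinearMap.ext_ring
  have := h S.1 S.2
  simpa [vS, S.2] using this

theorem whop_vS {n : ℕ} (w : Finset ℤ → ℤ) {a : ℤ} (b : ℤ) (ha : a ∈ Iset n) (T : Finset ℤ) :
    whop n w a b (vS n T) =
      if a ∈ T ∧ b ∉ T then (qv ^ w T) • vS n (insert b (T.erase a)) else 0 := by
  by_cases hT : T ⊆ Iset n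
  · exact mkOp_vS
      (fun S => if a ∈ S ∧ b ∉ S then (qv ^ w S) • vS n (insert b (S.erase a)) else 0) hT
  · rw [vS_of_not_subset hT, map_zero, vS_of_not_subset, smul_zero, ite_self]
    intro h
    apply hT
    intro x hx
    by_cases hxa : x = a
    · exact hxa ▸ ha
    · exact h (Finset.mem_insert_of_mem (Finset.mem_erase.2 ⟨hxa, hx⟩))

theorem qdiag_vS {n : ℕ} (w : Finset ℤ → ℤ) (T : Finset ℤ) :
    qdiag n w (vS n T) = (qv ^ w T) • vS n T := by
  by_cases hT : T ⊆ Iset n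
  · simp [qdiag, mkOp, vS, hT, bv]
  · simp [vS_of_not_subset hT]

theorem qdiag_mul {n : ℕ} (w w' : Finset ℤ → ℤ) :
    qdiag n w * qdiag n w' = qdiag n (fun S => w S + w' S) := by
  apply end_ext
  intro T _
  simp only [Module.End.mul_apply, qdiag_vS, map_smul, smul_smul]
  rw [zpow_add₀ qv_ne_zero, mul_comm]

theorem qdiag_zero {n : ℕ} : qdiag n (fun _ => 0) = 1 := by
  apply end_ext
  intro T _
  simp [qdiag_vS]

theorem qdiag_mul_whop_mul_qdiag {n : ℕ} {w w' : Finset ℤ → ℤ} {a b m : ℤ} (ha : a ∈ Iset n)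
    (h : ∀ T, a ∈ T → b ∉ T → w (insert b (T.erase a)) = w T + m) :
    qdiag n w * whop n w' a b * qdiag n (fun S => -w S) = qv ^ m • whop n w' a b := by
  apply end_ext
  intro T _
  simp only [Module.End.mul_apply, qdiag_vS, map_smul, whop_vS _ _ ha, LinearMap.smul_apply]
  split_ifs with hT
  · simp only [map_smul, qdiag_vS, smul_smul, h T hT.1 hT.2, ← zpow_add₀ qv_ne_zero]
    congr 2
    ring
  · simp

theorem whop_comm {n : ℕ} {w w' : Finset ℤ → ℤ} {a b c d : ℤ} (m : ℤ)
    (ha : a ∈ Iset n) (hc : c ∈ Iset n) (had : a ≠ d) (hbc : b ≠ c)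
    (h : ∀ T, a ∈ T → c ∈ T → b ∉ T → d ∉ T → a ≠ c → b ≠ d →
      w (insert d (T.erase c)) + w' T = m + (w T + w' (insert b (T.erase a)))) :
    whop n w a b * whop n w' c d = qv ^ m • (whop n w' c d * whop n w a b) := by
  apply end_ext
  intro T _
  simp only [Module.End.mul_apply, whop_vS _ _ ha, whop_vS _ _ hc, LinearMap.smul_apply,
    apply_ite (whop n w a b), apply_ite (whop n w' c d), map_smul, map_zero]
  by_cases hT : a ∈ T ∧ c ∈ T ∧ b ∉ T ∧ d ∉ T ∧ a ≠ c ∧ b ≠ d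
  · obtain ⟨h1, h2, h3, h4, h5, h6⟩ := hT
    have hset : insert b ((insert d (T.erase c)).erase a)
        = insert d ((insert b (T.erase a)).erase c) := by
      ext x; grind
    simp only [h1, h2, h3, h4, not_false_eq_true, and_self, if_true, Finset.mem_insert,
      Finset.mem_erase, had, hbc, h5, h5.symm, h6, h6.symm, ne_eq, false_or,
      hset, smul_smul, ← zpow_add₀ qv_ne_zero, had.symm, hbc.symm, and_false, or_false]
    congr 2
    have := h T h1 h2 h3 h4 h5 h6
    linarith
  · have e1 : ¬ ((c ∈ T ∧ d ∉ T) ∧ a ∈ insert d (T.erase c) ∧ b ∉ insert d (T.erase c)) := by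
      grind
    have e2 : ¬ ((a ∈ T ∧ b ∉ T) ∧ c ∈ insert b (T.erase a) ∧ d ∉ insert b (T.erase a)) := by
      grind
    rw [not_and] at e1 e2
    split_ifs <;> simp_all

theorem whop_sq {n : ℕ} {w w' : Finset ℤ → ℤ} {a b : ℤ} (ha : a ∈ Iset n) :
    whop n w a b * whop n w' a b = 0 := by
  apply end_ext
  intro T _
  simp only [Module.End.mul_apply, whop_vS _ _ ha]
  split_ifs with hT
  · simp [map_smul, whop_vS _ _ ha]
  · simp

theorem whop_sandwich {n : ℕ} {w w' w'' : Finset ℤ → ℤ} {a b c d : ℤ} (ha : a ∈ Iset n)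
    (hc : c ∈ Iset n) (h : ¬ (c = b ∧ d = a)) :
    whop n w a b * whop n w' c d * whop n w'' a b = 0 := by
  apply end_ext
  intro T _
  simp only [Module.End.mul_apply, whop_vS _ _ ha, LinearMap.zero_apply]
  split_ifs with hT
  · rw [map_smul, whop_vS _ _ hc]
    split_ifs with hT'
    · rw [map_smul, map_smul, whop_vS _ _ ha, if_neg, smul_zero, smul_zero]
      grind
    · simp
  · simp

/-- The common shape of `f_i` and `e_i` for `i < n`. -/
def ladder (n : ℕ) (p p' m m' : ℤ) : Module.End Fq (Lam n) :=
  whop n (fun _ => 0) m' m + whop n (fun S => occ m S - occ m' S) p p'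

theorem inter_quad_eq_iff {i : ℤ} {S A : Finset ℤ} (hA : A ⊆ quad i) :
    S ∩ quad i = A ↔ (i ∈ S ↔ i ∈ A) ∧ (i + 1 ∈ S ↔ i + 1 ∈ A) ∧ (-i ∈ S ↔ -i ∈ A) ∧
      (-(i + 1) ∈ S ↔ -(i + 1) ∈ A) := by
  constructor
  · rintro rfl
    simp [quad]
  · rintro ⟨h1, h2, h3, h4⟩
    ext x
    have := @hA x
    simp only [quad, Finset.mem_inter, Finset.mem_insert, Finset.mem_singleton] at this ⊢
    grind

theorem fop_eq_ladder {n : ℕ} {i : ℤ} (h1 : 1 ≤ i) (h2 : i < n) :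
    fop n i = ladder n i (i + 1) (-i) (-(i + 1)) := by
  apply end_ext
  intro T hT
  have n1 : i + 1 ≠ i := by omega
  have n2 : -i ≠ i := by omega
  have n3 : -(i + 1) ≠ i := by omega
  have n4 : -i ≠ i + 1 := by omega
  have n5 : -(i + 1) ≠ i + 1 := by omega
  have n6 : -(i + 1) ≠ -i := by omega
  rw [fop, mkOp_vS (fun S => fAct n i S) hT, ladder, LinearMap.add_apply,
    whop_vS _ _ (by simp [Iset]; omega), whop_vS _ _ (by simp [Iset]; omega), fAct,
    if_neg h2.ne]
  generalize vS n (insert (-i) (T.erase (-(i + 1)))) = u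
  generalize vS n (insert (i + 1) (T.erase i)) = v
  have key {A : Finset ℤ} (hA : A ⊆ quad i) := inter_quad_eq_iff (S := T) hA
  have s1 := key (A := {i}) (by simp [quad, -neg_add_rev])
  have s2 := key (A := {-(i + 1)}) (by simp [quad, -neg_add_rev])
  have s3 := key (A := {i, -(i + 1)}) (by simp [quad, Finset.insert_subset_iff, -neg_add_rev])
  have s4 := key (A := {i, -i}) (by simp [quad, Finset.insert_subset_iff, -neg_add_rev])
  have s5 := key (A := {i + 1, -(i + 1)}) (by simp [quad, Finset.insert_subset_iff, -neg_add_rev])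
  have s6 := key (A := {i, -(i + 1), -i}) (by simp [quad, Finset.insert_subset_iff, -neg_add_rev])
  have s7 := key (A := {i, i + 1, -(i + 1)})
    (by simp [quad, Finset.insert_subset_iff, -neg_add_rev])
  simp only [Finset.mem_insert, Finset.mem_singleton, n1, n2, n3, n4, n5, n6, n1.symm, n2.symm,
    n3.symm, n4.symm, n5.symm, n6.symm, or_false, or_true, iff_true,
    iff_false] at s1 s2 s3 s4 s5 s6 s7
  simp only [s1, s2, s3, s4, s5, s6, s7, occ, zpow_zero, one_smul]
  by_cases c1 : i ∈ T <;> by_cases c2 : i + 1 ∈ T <;> by_cases c3 : -i ∈ T <;>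
    by_cases c4 : -(i + 1) ∈ T <;> simp [c1, c2, c3, c4, -neg_add_rev]

theorem eop_eq_ladder {n : ℕ} {i : ℤ} (h1 : 1 ≤ i) (h2 : i < n) :
    eop n i = ladder n (-i) (-(i + 1)) i (i + 1) := by
  apply end_ext
  intro T hT
  have n1 : i + 1 ≠ i := by omega
  have n2 : -i ≠ i := by omega
  have n3 : -(i + 1) ≠ i := by omega
  have n4 : -i ≠ i + 1 := by omega
  have n5 : -(i + 1) ≠ i + 1 := by omega
  have n6 : -(i + 1) ≠ -i := by omega
  rw [eop, mkOp_vS (fun S => eAct n i S) hT, ladder, LinearMap.add_apply,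
    whop_vS _ _ (by simp [Iset]; omega), whop_vS _ _ (by simp [Iset]; omega), eAct,
    if_neg h2.ne]
  generalize vS n (insert i (T.erase (i + 1))) = u
  generalize vS n (insert (-(i + 1)) (T.erase (-i))) = v
  have key {A : Finset ℤ} (hA : A ⊆ quad i) := inter_quad_eq_iff (S := T) hA
  have s1 := key (A := {-i}) (by simp [quad, -neg_add_rev])
  have s2 := key (A := {i + 1}) (by simp [quad, -neg_add_rev])
  have s3 := key (A := {i + 1, -i}) (by simp [quad, Finset.insert_subset_iff, -neg_add_rev])
  have s4 := key (A := {i, -i}) (by simp [quad, Finset.insert_subset_iff, -neg_add_rev])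
  have s5 := key (A := {i + 1, -(i + 1)}) (by simp [quad, Finset.insert_subset_iff, -neg_add_rev])
  have s6 := key (A := {i, i + 1, -i}) (by simp [quad, Finset.insert_subset_iff, -neg_add_rev])
  have s7 := key (A := {i + 1, -(i + 1), -i})
    (by simp [quad, Finset.insert_subset_iff, -neg_add_rev])
  simp only [Finset.mem_insert, Finset.mem_singleton, n1, n2, n3, n4, n5, n6, n1.symm, n2.symm,
    n3.symm, n4.symm, n5.symm, n6.symm, or_false, or_true, iff_true,
    iff_false] at s1 s2 s3 s4 s5 s6 s7
  simp only [s1, s2, s3, s4, s5, s6, s7, occ, zpow_zero, one_smul]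
  by_cases c1 : i ∈ T <;> by_cases c2 : i + 1 ∈ T <;> by_cases c3 : -i ∈ T <;>
    by_cases c4 : -(i + 1) ∈ T <;> simp [c1, c2, c3, c4, -neg_add_rev]

theorem fop_last {n : ℕ} (hn : 1 ≤ n) : fop n n = whop n (fun _ => 0) n (-n) := by
  apply end_ext
  intro T hT
  rw [fop, mkOp_vS (fun S => fAct n n S) hT, whop_vS _ _ (by simp [Iset]; omega)]
  simp [fAct]

theorem eop_last {n : ℕ} (hn : 1 ≤ n) : eop n n = whop n (fun _ => 0) (-n) n := by
  apply end_ext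
  intro T hT
  rw [eop, mkOp_vS (fun S => eAct n n S) hT, whop_vS _ _ (by simp [Iset]; omega)]
  simp [eAct]

theorem kop_eq (n : ℕ) (i : ℤ) : kop n i = qdiag n (alphaPair n i) := rfl

theorem kinvop_eq (n : ℕ) (i : ℤ) : kinvop n i = qdiag n (fun S => -alphaPair n i S) := rfl

theorem sum_avec_mul {n : ℕ} {i : ℤ} (hi : 1 ≤ i) (hin : i ≤ n) (g : ℤ → ℤ) :
    ∑ t ∈ Finset.Icc (1 : ℤ) (n : ℤ), avec n i t * g t =
      if i = n then 2 * g n else g i - g (i + 1) := by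
  unfold avec
  split_ifs with h
  · rw [Finset.sum_eq_single (n : ℤ)]
    · simp
    · intro b _ hb
      simp [hb]
    · intro hb
      exact absurd (Finset.mem_Icc.2 ⟨by omega, le_rfl⟩) hb
  · have : ∀ t : ℤ, (if t = i then (1 : ℤ) else if t = i + 1 then -1 else 0) * g t
        = (if t = i then g t else 0) - (if t = i + 1 then g t else 0) := by
      intro t
      split_ifs <;> omega
    simp only [this, Finset.sum_sub_distrib, Finset.sum_ite_eq', Finset.mem_Icc]
    rw [if_pos (by omega), if_pos (by omega)]

theorem ip_eq {n : ℕ} {i : ℤ} (hi : 1 ≤ i) (hin : i ≤ n) (j : ℤ) :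
    ip n i j = if i = n then 2 * avec n j n else avec n j i - avec n j (i + 1) :=
  sum_avec_mul hi hin _

theorem occ_move {p a b : ℤ} {T : Finset ℤ} (ha : a ∈ T) (hb : b ∉ T) :
    occ p (insert b (T.erase a)) =
      occ p T + (if p = b then 1 else 0) - (if p = a then 1 else 0) := by
  unfold occ
  grind

theorem alphaPair_eq (n : ℕ) (i : ℤ) (S : Finset ℤ) :
    alphaPair n i S = if i = n then 2 * (occ n S - occ (-n) S)
      else (occ i S - occ (-i) S) - (occ (i + 1) S - occ (-(i + 1)) S) := rfl

theorem alphaPair_move_of_lt {n : ℕ} {i a b : ℤ} {T : Finset ℤ} (hi : i < n) (ha : a ∈ T)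
    (hb : b ∉ T) :
    alphaPair n i (insert b (T.erase a)) = alphaPair n i T +
      (((if i = b then 1 else 0) - (if i = a then 1 else 0)) -
        ((if -i = b then 1 else 0) - (if -i = a then 1 else 0)) -
        ((if i + 1 = b then 1 else 0) - (if i + 1 = a then 1 else 0)) +
        ((if -(i + 1) = b then 1 else 0) - (if -(i + 1) = a then 1 else 0))) := by
  simp only [alphaPair_eq, if_neg hi.ne, occ_move ha hb]
  ring

theorem alphaPair_move_self {n : ℕ} {a b : ℤ} {T : Finset ℤ} (ha : a ∈ T) (hb : b ∉ T) :
    alphaPair n n (insert b (T.erase a)) = alphaPair n n T +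
      2 * (((if (n : ℤ) = b then 1 else 0) - (if (n : ℤ) = a then 1 else 0)) -
        ((if (-n : ℤ) = b then 1 else 0) - (if (-n : ℤ) = a then 1 else 0))) := by
  simp only [alphaPair_eq, if_true, occ_move ha hb]
  ring

theorem int_adjacency (i j : ℤ) :
    j + 1 < i ∨ j + 1 = i ∨ j = i ∨ j = i + 1 ∨ i + 1 < j := by
  omega

theorem kop_mul_eop_mul_kinvop {n : ℕ} {i j : ℤ} (hi : 1 ≤ i) (hin : i ≤ n) (hj : 1 ≤ j)
    (hjn : j ≤ n) : kop n i * eop n j * kinvop n i = qv ^ ip n i j • eop n j := by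
  rw [kop_eq, kinvop_eq, ip_eq hi hin]
  unfold avec
  rcases hjn.lt_or_eq with hjn' | rfl
  · rw [eop_eq_ladder hj hjn', ladder, mul_add, add_mul, smul_add,
      qdiag_mul_whop_mul_qdiag, qdiag_mul_whop_mul_qdiag]
    any_goals simp [Iset]; omega
    all_goals
      intro T ha hb
      rcases hin.lt_or_eq with hin' | rfl
      · rw [alphaPair_move_of_lt hin' ha hb]
        rcases int_adjacency i j with h | h | h | h | h <;>
          first
          | (exfalso; omega)
          | (simp (disch := omega) only [if_pos, if_neg]; norm_num)
      · rw [alphaPair_move_self ha hb]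
        rcases int_adjacency n j with h | h | h | h | h <;>
          first
          | (exfalso; omega)
          | (simp (disch := omega) only [if_pos, if_neg]; norm_num)
  · rw [eop_last (by omega), qdiag_mul_whop_mul_qdiag]
    · simp [Iset]; omega
    · intro T ha hb
      rcases hin.lt_or_eq with hin' | rfl
      · rw [alphaPair_move_of_lt hin' ha hb]
        rcases int_adjacency i n with h | h | h | h | h <;>
          first
          | (exfalso; omega)
          | (simp (disch := omega) only [if_pos, if_neg]; norm_num)
      · rw [alphaPair_move_self ha hb]
        simp (disch := omega) only [if_pos, if_neg]
        norm_num

theorem kop_mul_fop_mul_kinvop {n : ℕ} {i j : ℤ} (hi : 1 ≤ i) (hin : i ≤ n) (hj : 1 ≤ j)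
    (hjn : j ≤ n) : kop n i * fop n j * kinvop n i = qv ^ (-ip n i j) • fop n j := by
  rw [kop_eq, kinvop_eq, ip_eq hi hin]
  unfold avec
  rcases hjn.lt_or_eq with hjn' | rfl
  · rw [fop_eq_ladder hj hjn', ladder, mul_add, add_mul, smul_add,
      qdiag_mul_whop_mul_qdiag, qdiag_mul_whop_mul_qdiag]
    any_goals simp [Iset]; omega
    all_goals
      intro T ha hb
      rcases hin.lt_or_eq with hin' | rfl
      · rw [alphaPair_move_of_lt hin' ha hb]
        rcases int_adjacency i j with h | h | h | h | h <;>
          first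
          | (exfalso; omega)
          | (simp (disch := omega) only [if_pos, if_neg]; norm_num)
      · rw [alphaPair_move_self ha hb]
        rcases int_adjacency n j with h | h | h | h | h <;>
          first
          | (exfalso; omega)
          | (simp (disch := omega) only [if_pos, if_neg]; norm_num)
  · rw [fop_last (by omega), qdiag_mul_whop_mul_qdiag]
    · simp [Iset]; omega
    · intro T ha hb
      rcases hin.lt_or_eq with hin' | rfl
      · rw [alphaPair_move_of_lt hin' ha hb]
        rcases int_adjacency i n with h | h | h | h | h <;>
          first
          | (exfalso; omega)
          | (simp (disch := omega) only [if_pos, if_neg]; norm_num)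
      · rw [alphaPair_move_self ha hb]
        simp (disch := omega) only [if_pos, if_neg]
        norm_num

theorem whop_bracket {n : ℕ} {w w' : Finset ℤ → ℤ} {a b : ℤ} (ha : a ∈ Iset n)
    (hb : b ∈ Iset n) (hw : ∀ T, a ∈ T → b ∉ T → w (insert b (T.erase a)) = w T)
    (hw' : ∀ T, b ∈ T → a ∉ T → w' (insert a (T.erase b)) = w' T) (T : Finset ℤ) :
    (whop n w b a * whop n w' a b - whop n w' a b * whop n w b a) (vS n T) =
      (((occ a T - occ b T : ℤ) : Fq) * qv ^ (w T + w' T)) • vS n T := by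
  simp only [LinearMap.sub_apply, Module.End.mul_apply, whop_vS _ _ ha, whop_vS _ _ hb, occ]
  by_cases h1 : a ∈ T <;> by_cases h2 : b ∈ T
  · simp [h1, h2]
  · have hab : a ≠ b := fun h => h2 (h ▸ h1)
    simp [h1, h2, whop_vS _ _ hb, hab, hw T h1 h2, smul_smul, zpow_add₀ qv_ne_zero, mul_comm]
  · have hab : b ≠ a := fun h => h1 (h ▸ h2)
    simp [h1, h2, whop_vS _ _ ha, hab, hw' T h2 h1, smul_smul, zpow_add₀ qv_ne_zero]
  · simp [h1, h2]

theorem qv_sub_inv_ne_zero : qv - qv⁻¹ ≠ 0 := by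
  have h := qv_pow_ne_one (k := 2) (by norm_num)
  have h0 := qv_ne_zero
  intro h'
  apply h
  field_simp at h'
  linear_combination h'

theorem qv_sq_sub_inv_ne_zero : qv ^ 2 - (qv ^ 2)⁻¹ ≠ 0 := by
  have h := qv_pow_ne_one (k := 4) (by norm_num)
  have h0 := qv_ne_zero
  intro h'
  apply h
  field_simp at h'
  linear_combination h'

theorem whop_commute {n : ℕ} {w w' : Finset ℤ → ℤ} {a b c d : ℤ} (ha : a ∈ Iset n)
    (hc : c ∈ Iset n) (had : a ≠ d) (hbc : b ≠ c)
    (h : ∀ T, a ∈ T → c ∈ T → b ∉ T → d ∉ T → a ≠ c → b ≠ d →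
      w (insert d (T.erase c)) + w' T = 0 + (w T + w' (insert b (T.erase a)))) :
    whop n w a b * whop n w' c d = whop n w' c d * whop n w a b := by
  rw [whop_comm 0 ha hc had hbc h, zpow_zero, one_smul]

theorem add_mul_of_commute {R : Type*} [Semiring R] {a b c : R} (hac : a * c = c * a)
    (hbc : b * c = c * b) : (a + b) * c = c * (a + b) := by
  rw [add_mul, mul_add, hac, hbc]

theorem mul_add_of_commute {R : Type*} [Semiring R] {a b c : R} (hab : a * b = b * a)
    (hac : a * c = c * a) : a * (b + c) = (b + c) * a := by
  rw [add_mul, mul_add, hab, hac]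

theorem eop_mul_fop_of_ne {n : ℕ} {i j : ℤ} (hi : 1 ≤ i) (hin : i ≤ n) (hj : 1 ≤ j)
    (hjn : j ≤ n) (hij : i ≠ j) : eop n i * fop n j = fop n j * eop n i := by
  rcases hin.lt_or_eq with hin' | rfl <;> rcases hjn.lt_or_eq with hjn' | rfl
  · rw [eop_eq_ladder hi hin', fop_eq_ladder hj hjn']
    apply add_mul_of_commute <;> apply mul_add_of_commute
    all_goals
      apply whop_commute
      all_goals first
        | omega
        | (simp [Iset]; omega)
        | intro T ha hc hb hd _ _
          simp only [occ_move ha hb, occ_move hc hd]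
          rcases int_adjacency i j with h | h | h | h | h <;> first
            | (exfalso; omega)
            | (simp (disch := omega) only [if_neg]; ring1)
            | (simp (disch := omega) only [if_pos, if_neg]; ring)
  · rw [eop_eq_ladder hi hin', fop_last (by omega)]
    apply add_mul_of_commute
    all_goals
      apply whop_commute
      all_goals first
        | omega
        | (simp [Iset]; omega)
        | intro T ha hc hb hd _ _
          simp only [occ_move hc hd]
          rcases int_adjacency i n with h | h | h | h | h <;> first
            | (exfalso; omega)
            | (simp (disch := omega) only [if_neg]; ring1)
  · rw [eop_last (by omega), fop_eq_ladder hj hjn']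
    apply mul_add_of_commute
    all_goals
      apply whop_commute
      all_goals first
        | omega
        | (simp [Iset]; omega)
        | intro T ha hc hb hd _ _
          simp only [occ_move ha hb]
          rcases int_adjacency j n with h | h | h | h | h <;> first
            | (exfalso; omega)
            | (simp (disch := omega) only [if_neg]; ring1)
  · exact absurd rfl hij

theorem eop_fop_bracket_self {n : ℕ} {i : ℤ} (hi : 1 ≤ i) (hin : i ≤ n) :
    eop n i * fop n i - fop n i * eop n i =
      (qsub n i - (qsub n i)⁻¹)⁻¹ • (kop n i - kinvop n i) := by
  have h0 := qv_ne_zero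
  rw [kop_eq, kinvop_eq]
  rcases hin.lt_or_eq with hin' | rfl
  · rw [eop_eq_ladder hi hin', fop_eq_ladder hi hin', ladder, ladder]
    have reorder (B A Y X : Module.End Fq (Lam n)) (h1 : B * Y = Y * B) (h2 : A * X = X * A) :
        (B + A) * (Y + X) - (Y + X) * (B + A) = (B * X - X * B) + (A * Y - Y * A) := by
      rw [mul_add, add_mul, add_mul, mul_add, add_mul, add_mul, h1, h2]
      abel
    rw [reorder]
    · apply end_ext
      intro T _
      rw [LinearMap.add_apply, whop_bracket, whop_bracket, LinearMap.smul_apply,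
        LinearMap.sub_apply, qdiag_vS, qdiag_vS, ← sub_smul, smul_smul, ← add_smul]
      · congr 1
        rw [qsub, if_neg hin'.ne, alphaPair_eq, if_neg hin'.ne]
        have h1 := qv_sub_inv_ne_zero
        rw [eq_inv_mul_iff_mul_eq₀ h1]
        unfold occ
        generalize -i = i₁
        generalize -(i + 1) = i₂
        generalize i + 1 = i₃
        by_cases c1 : i ∈ T <;> by_cases c2 : i₁ ∈ T <;> by_cases c3 : i₂ ∈ T <;>
          by_cases c4 : i₃ ∈ T <;> simp only [c1, c2, c3, c4, if_true, if_false] <;>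
          norm_num [zpow_neg] <;> field_simp <;> ring
      any_goals first
        | (simp [Iset]; omega)
        | (intro T ha hb; rfl)
      all_goals
        intro T ha hb
        simp only [occ_move ha hb]
        simp (disch := omega) only [if_neg]
        ring
    all_goals
      apply whop_commute
      all_goals first
        | omega
        | (simp [Iset]; omega)
        | intro T ha hc hb hd _ _
          try simp only [occ_move ha hb, occ_move hc hd]
          simp (disch := omega) only [if_neg]
          try ring
  · rw [eop_last (by omega), fop_last (by omega)]
    apply end_ext
    intro T _
    rw [whop_bracket, LinearMap.smul_apply,
      LinearMap.sub_apply, qdiag_vS, qdiag_vS, ← sub_smul, smul_smul]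
    · congr 1
      rw [qsub, if_pos rfl, alphaPair_eq, if_pos rfl]
      have h1 := qv_sq_sub_inv_ne_zero
      rw [eq_inv_mul_iff_mul_eq₀ h1]
      unfold occ
      generalize -(n : ℤ) = i₁
      by_cases c1 : (n : ℤ) ∈ T <;> by_cases c2 : i₁ ∈ T <;>
        simp only [c1, c2, if_true, if_false] <;> norm_num [zpow_neg]
    all_goals first
      | (simp [Iset]; omega)
      | (intro T ha hb; rfl)

theorem mul_mul_eq_zero {R : Type*} [Semiring R] {X Y : R} (h : X * Y = 0) (Z : R) :
    X * (Y * Z) = 0 := by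
  rw [← mul_assoc, h, zero_mul]

section Serre

variable {K R : Type*} [Field K] [Semiring R] [Algebra K R] {q : K}

theorem mul_mul_eq_smul {X Y : R} {c : K} (h : X * Y = c • (Y * X)) (Z : R) :
    X * (Y * Z) = c • (Y * (X * Z)) := by
  rw [← mul_assoc, h, smul_mul_assoc, mul_assoc]

theorem serre_ladder (h0 : q ≠ 0) {X Y X' Y' : R} (hXY : X * Y = q ^ (2 : ℤ) • (Y * X))
    (hXY' : X * Y' = q ^ (-1 : ℤ) • (Y' * X)) (hX'Y : X' * Y = q ^ (-1 : ℤ) • (Y * X'))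
    (hX : X * X = 0) (hY : Y * Y = 0) (hXX' : X * X' * X = 0) (hYY' : Y * Y' * Y = 0) :
    (Y + X) ^ 2 * (Y' + X') + (-(q + q⁻¹)) • ((Y + X) * (Y' + X') * (Y + X))
      + (Y' + X') * (Y + X) ^ 2 = 0 := by
  rw [mul_assoc] at hXX' hYY'
  simp only [pow_two, mul_add, add_mul, mul_assoc, hXY, hXY', hX'Y, hX, hY, hXX', hYY',
    mul_mul_eq_smul hXY, mul_mul_eq_smul hX'Y, mul_mul_eq_zero hY, smul_zero, mul_zero, add_zero,
    zero_add, mul_smul_comm, smul_mul_assoc]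
  match_scalars <;> simp <;> field_simp <;> ring

theorem serre_last_ladder {X Y Z : R} (hZ : Z * Z = 0) (hZX : Z * X * Z = 0)
    (hZY : Z * Y * Z = 0) (c : K) :
    Z ^ 2 * (Y + X) + c • (Z * (Y + X) * Z) + (Y + X) * Z ^ 2 = 0 := by
  simp [pow_two, hZ, mul_add, add_mul, hZX, hZY]

theorem serre_ladder_last (h0 : q ≠ 0) {X Y Z : R} (hXY : X * Y = q ^ (2 : ℤ) • (Y * X))
    (hX : X * X = 0) (hY : Y * Y = 0) (hXZ : X * Z * X = 0) (hYZ : Y * Z * Y = 0) (c d : K) :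
    (Y + X) ^ 3 * Z + c • ((Y + X) ^ 2 * Z * (Y + X)) + d • ((Y + X) * Z * (Y + X) ^ 2)
      + (-1 : K) • (Z * (Y + X) ^ 3) = 0 := by
  have hYX : Y * X = q ^ (-2 : ℤ) • (X * Y) := by
    rw [hXY, smul_smul, ← zpow_add₀ h0]
    simp
  have hsq : (Y + X) ^ 2 = (1 + q ^ (2 : ℤ)) • (Y * X) := by
    simp only [pow_two, mul_add, add_mul, hX, hY, hXY]
    module
  have hcube : (Y + X) ^ 3 = 0 := by
    rw [pow_succ, hsq, smul_mul_assoc, mul_add, mul_assoc, mul_assoc, hX, hXY, mul_smul_comm,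
      ← mul_assoc, hY]
    simp
  have h1 : Y * X * Z * (Y + X) = 0 := by
    rw [mul_add, mul_assoc Y X Z, mul_assoc Y _ X, hXZ, ← mul_assoc, hYX]
    simp only [mul_assoc, smul_mul_assoc] at hYZ ⊢
    simp [hYZ]
  have h2 : (Y + X) * Z * (Y * X) = 0 := by
    rw [add_mul, add_mul, ← mul_assoc, hYZ, zero_mul, hYX, mul_smul_comm, ← mul_assoc, hXZ]
    simp
  rw [hcube, hsq, smul_mul_assoc, smul_mul_assoc, h1, mul_smul_comm, h2]
  simp

end Serre

theorem qFact_one {x : Fq} (hx : x - x⁻¹ ≠ 0) : qFact x 1 = 1 := by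
  simp [qFact, qNum, div_self hx]

theorem qNum_two {x : Fq} (hx0 : x ≠ 0) (hx : x - x⁻¹ ≠ 0) : qNum x 2 = x + x⁻¹ := by
  rw [qNum, div_eq_iff hx, zpow_neg]
  norm_cast
  field_simp
  ring

theorem qFact_two {x : Fq} (hx0 : x ≠ 0) (hx : x - x⁻¹ ≠ 0) : qFact x 2 = x + x⁻¹ := by
  rw [qFact, Finset.prod_range_succ, ← qFact, qFact_one hx, one_mul, qNum_two hx0 hx]

theorem qFact_ne_zero {x : Fq} (hx0 : x ≠ 0) (h : ∀ k : ℕ, k ≠ 0 → x ^ k ≠ 1) (m : ℕ) :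
    qFact x m ≠ 0 := by
  have key (k : ℕ) (hk : k ≠ 0) : x ^ (k : ℤ) - x ^ (-(k : ℤ)) ≠ 0 := by
    intro h'
    apply h (k + k) (by omega)
    rw [zpow_neg, zpow_natCast] at h'
    have hk0 : x ^ k ≠ 0 := pow_ne_zero _ hx0
    field_simp at h'
    rw [pow_add]
    linear_combination h'
  refine Finset.prod_ne_zero_iff.2 fun j _ => div_ne_zero (key (j + 1) (by omega)) ?_
  simpa using key 1 one_ne_zero

theorem qBinom_zero {x : Fq} (hx0 : x ≠ 0) (h : ∀ k : ℕ, k ≠ 0 → x ^ k ≠ 1) (m : ℕ) :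
    qBinom x m 0 = 1 := by
  rw [qBinom, Nat.sub_zero, div_eq_one_iff_eq]
  · simp [qFact]
  · exact mul_ne_zero (qFact_ne_zero hx0 h _) (qFact_ne_zero hx0 h _)

theorem qBinom_self {x : Fq} (hx0 : x ≠ 0) (h : ∀ k : ℕ, k ≠ 0 → x ^ k ≠ 1) (m : ℕ) :
    qBinom x m m = 1 := by
  rw [qBinom, Nat.sub_self, div_eq_one_iff_eq]
  · simp [qFact]
  · exact mul_ne_zero (qFact_ne_zero hx0 h _) (qFact_ne_zero hx0 h _)

theorem qBinom_two_one {x : Fq} (hx0 : x ≠ 0) (hx : x - x⁻¹ ≠ 0) :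
    qBinom x 2 1 = x + x⁻¹ := by
  rw [qBinom, qFact_two hx0 hx, qFact_one hx, mul_one, div_one]

theorem qsub_ne_zero (n : ℕ) (i : ℤ) : qsub n i ≠ 0 := by
  unfold qsub
  split_ifs
  exacts [pow_ne_zero _ qv_ne_zero, qv_ne_zero]

theorem qsub_pow_ne_one (n : ℕ) (i : ℤ) (k : ℕ) (hk : k ≠ 0) : qsub n i ^ k ≠ 1 := by
  unfold qsub
  split_ifs
  · rw [← pow_mul]
    exact qv_pow_ne_one (by omega)
  · exact qv_pow_ne_one hk

/-- The left hand side of the quantum Serre relation. -/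
def serreSum {R : Type*} [Semiring R] [Algebra Fq R] (x : Fq) (N : ℕ) (F F' : R) : R :=
  ∑ s ∈ Finset.range (N + 1), ((-1 : Fq) ^ s * qBinom x N s) • (F ^ (N - s) * F' * F ^ s)

theorem serreSum_eq_zero {R : Type*} [Semiring R] [Algebra Fq R] {n : ℕ} {i j : ℤ} (hi : 1 ≤ i)
    (hin : i ≤ n) (hj : 1 ≤ j) (hjn : j ≤ n) (hij : i ≠ j) {F F' : R}
    (hfar : j + 1 < i ∨ i + 1 < j → F * F' = F' * F)
    (hladder : i < n → j < n → j + 1 = i ∨ j = i + 1 →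
      F ^ 2 * F' + (-(qv + qv⁻¹)) • (F * F' * F) + F' * F ^ 2 = 0)
    (hlast : i = n → j + 1 = n → ∀ c : Fq, F ^ 2 * F' + c • (F * F' * F) + F' * F ^ 2 = 0)
    (hlast' : i + 1 = n → j = n → ∀ c d : Fq,
      F ^ 3 * F' + c • (F ^ 2 * F' * F) + d • (F * F' * F ^ 2) + (-1 : Fq) • (F' * F ^ 3) = 0) :
    serreSum (qsub n i) (1 - aij n i j).toNat F F' = 0 := by
  have hx0 := qsub_ne_zero n i
  have hx1 := qsub_pow_ne_one n i
  have hB0 := qBinom_zero hx0 hx1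
  have hBN := qBinom_self hx0 hx1
  have haij : aij n i j = 2 * (if i = n then 2 * avec n j n else avec n j i - avec n j (i + 1)) /
      (if i = n then 2 * avec n i n else avec n i i - avec n i (i + 1)) := by
    rw [aij, ip_eq hi hin, ip_eq hi hin]
  unfold avec at haij
  unfold serreSum
  by_cases h : j + 1 < i ∨ i + 1 < j
  · have ha : aij n i j = 0 := by
      rw [haij]
      rcases h with h | h
      · rcases hin.lt_or_eq with hin' | rfl <;> simp (disch := omega) [if_neg]
      · rcases hjn.lt_or_eq with hjn' | rfl <;> simp (disch := omega) [if_neg]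
    have hN : (1 - aij n i j).toNat = 1 := by rw [ha]; rfl
    rw [hN, Finset.sum_range_succ, Finset.sum_range_one, hB0, hBN]
    simp only [pow_zero, pow_one, one_mul, mul_one, Nat.sub_zero, Nat.sub_self, hfar h]
    rw [← add_smul 1 (-1 : Fq), add_neg_cancel, zero_smul]
  · by_cases h' : i + 1 = n ∧ j = n
    · have ha : aij n i j = -2 := by
        rw [haij]
        simp (disch := omega) only [if_pos, if_neg]
        norm_num
      have hN : (1 - aij n i j).toNat = 3 := by rw [ha]; rfl
      rw [hN]
      simp only [Finset.sum_range_succ, Finset.range_zero, Finset.sum_empty, zero_add]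
      have hneg : (-1 : Fq) ^ 3 = -1 := by norm_num
      simpa [hB0, hBN, hneg] using hlast' h'.1 h'.2 (-qBinom (qsub n i) 3 1) (qBinom (qsub n i) 3 2)
    · have ha : aij n i j = -1 := by
        rw [haij]
        rcases int_adjacency i j with h1 | h1 | h1 | h1 | h1 <;>
          rcases hin.lt_or_eq with hin' | rfl <;> first
          | (exfalso; omega)
          | (simp (disch := omega) only [if_pos, if_neg]; norm_num)
      have hN : (1 - aij n i j).toNat = 2 := by rw [ha]; rfl
      rw [hN]
      simp only [Finset.sum_range_succ, Finset.range_zero, Finset.sum_empty, zero_add]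
      rcases hin.lt_or_eq with hin' | rfl
      · have := hladder hin' (by omega) (by omega)
        rw [← qBinom_two_one qv_ne_zero qv_sub_inv_ne_zero] at this
        have hx : qsub n i = qv := if_neg hin'.ne
        rw [hx] at hB0 hBN ⊢
        simpa [hB0, hBN] using this
      · simpa [hB0, hBN] using hlast rfl (by omega) (-qBinom (qsub n n) 2 1)

theorem fop_mul_fop_of_far {n : ℕ} {i j : ℤ} (hi : 1 ≤ i) (hj : 1 ≤ j)
    (hjn : j ≤ n) (hij : i + 1 < j) : fop n i * fop n j = fop n j * fop n i := by
  have hin' : i < n := by omega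
  rcases hjn.lt_or_eq with hjn' | rfl
  · rw [fop_eq_ladder hi hin', fop_eq_ladder hj hjn']
    apply add_mul_of_commute <;> apply mul_add_of_commute
    all_goals
      apply whop_commute
      all_goals first
        | omega
        | (simp [Iset]; omega)
        | intro T ha hc hb hd _ _
          simp only [occ_move ha hb, occ_move hc hd]
          simp (disch := omega) only [if_neg]
          ring
  · rw [fop_eq_ladder hi hin', fop_last (by omega)]
    apply add_mul_of_commute
    all_goals
      apply whop_commute
      all_goals first
        | omega
        | (simp [Iset]; omega)
        | intro T ha hc hb hd _ _
          simp only [occ_move hc hd]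
          simp (disch := omega) only [if_neg]
          ring

theorem eop_mul_eop_of_far {n : ℕ} {i j : ℤ} (hi : 1 ≤ i) (hj : 1 ≤ j)
    (hjn : j ≤ n) (hij : i + 1 < j) : eop n i * eop n j = eop n j * eop n i := by
  have hin' : i < n := by omega
  rcases hjn.lt_or_eq with hjn' | rfl
  · rw [eop_eq_ladder hi hin', eop_eq_ladder hj hjn']
    apply add_mul_of_commute <;> apply mul_add_of_commute
    all_goals
      apply whop_commute
      all_goals first
        | omega
        | (simp [Iset]; omega)
        | intro T ha hc hb hd _ _
          simp only [occ_move ha hb, occ_move hc hd]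
          simp (disch := omega) only [if_neg]
          ring
  · rw [eop_eq_ladder hi hin', eop_last (by omega)]
    apply add_mul_of_commute
    all_goals
      apply whop_commute
      all_goals first
        | omega
        | (simp [Iset]; omega)
        | intro T ha hc hb hd _ _
          simp only [occ_move hc hd]
          simp (disch := omega) only [if_neg]
          ring

theorem serreSum_fop {n : ℕ} {i j : ℤ} (hi : 1 ≤ i) (hin : i ≤ n) (hj : 1 ≤ j)
    (hjn : j ≤ n) (hij : i ≠ j) :
    serreSum (qsub n i) (1 - aij n i j).toNat (fop n i) (fop n j) = 0 := by
  refine serreSum_eq_zero hi hin hj hjn hij ?_ ?_ ?_ ?_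
  · rintro (h | h)
    · exact (fop_mul_fop_of_far hj hi hin h).symm
    · exact fop_mul_fop_of_far hi hj hjn h
  · intro hin' hjn' h
    rw [fop_eq_ladder hi hin', fop_eq_ladder hj hjn']
    refine serre_ladder qv_ne_zero (whop_comm _ ?_ ?_ ?_ ?_ ?_) (whop_comm _ ?_ ?_ ?_ ?_ ?_)
      (whop_comm _ ?_ ?_ ?_ ?_ ?_) (whop_sq ?_) (whop_sq ?_) (whop_sandwich ?_ ?_ ?_)
      (whop_sandwich ?_ ?_ ?_)
    all_goals first
      | omega
      | (simp [Iset]; omega)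
      | intro T ha hc hb hd _ _
        simp only [occ_move hc hd]
        rcases h with rfl | rfl <;> simp (disch := omega) only [if_neg, if_true] <;> ring
  · rintro rfl hj' c
    rw [fop_last (by omega), fop_eq_ladder hj (by omega)]
    refine serre_last_ladder (whop_sq ?_) (whop_sandwich ?_ ?_ ?_) (whop_sandwich ?_ ?_ ?_) c
    all_goals first
      | omega
      | (simp [Iset]; omega)
  · rintro hi' rfl c d
    rw [fop_last (by omega), fop_eq_ladder hi (by omega)]
    refine serre_ladder_last qv_ne_zero (whop_comm _ ?_ ?_ ?_ ?_ ?_) (whop_sq ?_) (whop_sq ?_)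
      (whop_sandwich ?_ ?_ ?_) (whop_sandwich ?_ ?_ ?_) c d
    all_goals first
      | omega
      | (simp [Iset]; omega)
      | intro T ha hc hb hd _ _
        simp only [occ_move hc hd]
        simp (disch := omega) only [if_neg, if_true]
        ring

theorem serreSum_eop {n : ℕ} {i j : ℤ} (hi : 1 ≤ i) (hin : i ≤ n) (hj : 1 ≤ j)
    (hjn : j ≤ n) (hij : i ≠ j) :
    serreSum (qsub n i) (1 - aij n i j).toNat (eop n i) (eop n j) = 0 := by
  refine serreSum_eq_zero hi hin hj hjn hij ?_ ?_ ?_ ?_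
  · rintro (h | h)
    · exact (eop_mul_eop_of_far hj hi hin h).symm
    · exact eop_mul_eop_of_far hi hj hjn h
  · intro hin' hjn' h
    rw [eop_eq_ladder hi hin', eop_eq_ladder hj hjn']
    refine serre_ladder qv_ne_zero (whop_comm _ ?_ ?_ ?_ ?_ ?_) (whop_comm _ ?_ ?_ ?_ ?_ ?_)
      (whop_comm _ ?_ ?_ ?_ ?_ ?_) (whop_sq ?_) (whop_sq ?_) (whop_sandwich ?_ ?_ ?_)
      (whop_sandwich ?_ ?_ ?_)
    all_goals first
      | omega
      | (simp [Iset]; omega)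
      | intro T ha hc hb hd _ _
        simp only [occ_move hc hd]
        rcases h with rfl | rfl <;> simp (disch := omega) only [if_neg, if_true] <;> ring
  · rintro rfl hj' c
    rw [eop_last (by omega), eop_eq_ladder hj (by omega)]
    refine serre_last_ladder (whop_sq ?_) (whop_sandwich ?_ ?_ ?_) (whop_sandwich ?_ ?_ ?_) c
    all_goals first
      | omega
      | (simp [Iset]; omega)
  · rintro hi' rfl c d
    rw [eop_last (by omega), eop_eq_ladder hi (by omega)]
    refine serre_ladder_last qv_ne_zero (whop_comm _ ?_ ?_ ?_ ?_ ?_) (whop_sq ?_) (whop_sq ?_)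
      (whop_sandwich ?_ ?_ ?_) (whop_sandwich ?_ ?_ ?_) c d
    all_goals first
      | omega
      | (simp [Iset]; omega)
      | intro T ha hc hb hd _ _
        simp only [occ_move hc hd]
        simp (disch := omega) only [if_neg, if_true]
        ring

/-- the operators e_i, f_i, k_i^{±1} on Λ satisfy the defining relations of
the quantum group U_q(sp_{2n}). -/
theorem stmt1 (n : ℕ) (hn : 1 ≤ n) :
    (∀ i ∈ Finset.Icc (1 : ℤ) (n : ℤ),
      kop n i * kinvop n i = 1 ∧ kinvop n i * kop n i = 1) ∧
    ∀ i ∈ Finset.Icc (1 : ℤ) (n : ℤ), ∀ j ∈ Finset.Icc (1 : ℤ) (n : ℤ),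
      (kop n i * kop n j = kop n j * kop n i) ∧
      (kop n i * eop n j * kinvop n i = (qv ^ ip n i j) • eop n j) ∧
      (kop n i * fop n j * kinvop n i = (qv ^ (-ip n i j)) • fop n j) ∧
      (eop n i * fop n j - fop n j * eop n i =
        if i = j then (qsub n i - (qsub n i)⁻¹)⁻¹ • (kop n i - kinvop n i) else 0) ∧
      (i ≠ j →
        (∑ s ∈ Finset.range ((1 - aij n i j).toNat + 1),
            ((-1 : Fq) ^ s * qBinom (qsub n i) (1 - aij n i j).toNat s) •
              (eop n i ^ ((1 - aij n i j).toNat - s) * eop n j * eop n i ^ s)) = 0 ∧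
        (∑ s ∈ Finset.range ((1 - aij n i j).toNat + 1),
            ((-1 : Fq) ^ s * qBinom (qsub n i) (1 - aij n i j).toNat s) •
              (fop n i ^ ((1 - aij n i j).toNat - s) * fop n j * fop n i ^ s)) = 0) := by
  refine ⟨fun i _ => ?_, fun i hi j hj => ?_⟩
  · rw [kop_eq, kinvop_eq, qdiag_mul, qdiag_mul, ← qdiag_zero]
    simp
  · obtain ⟨hi, hin⟩ := Finset.mem_Icc.1 hi
    obtain ⟨hj, hjn⟩ := Finset.mem_Icc.1 hj
    refine ⟨?_, kop_mul_eop_mul_kinvop hi hin hj hjn, kop_mul_fop_mul_kinvop hi hin hj hjn, ?_,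
      fun hij => ⟨serreSum_eop hi hin hj hjn hij, serreSum_fop hi hin hj hjn hij⟩⟩
    · simp only [kop_eq, qdiag_mul, add_comm]
    · split_ifs with hij
      · subst hij
        exact eop_fop_bracket_self hi hin
      · rw [eop_mul_fop_of_ne hi hin hj hjn hij]
        exact sub_self (fop n j * eop n i)

end
end
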